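/- Let G be a finite metacyclic group, p ∈ π_G, and G_p a Sylow p-subgroup of G. Write p^μ = m^{G_p}, p^ν = n^{G_p}, p^σ = s^{G_p}, p^ρ = r^{G_p}, e = ε^{G_p}, and m_p = (m^G)_p, n_p = (n^G)_p, s_p = (s^G)_p, r_p = (r^G)_p, k_p = (k^G)_p. Suppose e^{p−1} = 1 (i.e. p is odd or e = 1). Then: (a) if p = 2 then ε^G = 1; (b) m_p/r_p = p^{μ−ρ} and the exponent of G_p equals m_p·n_p/s_p = p^{μ+ν−σ}; (c) if m_p ≠ p^μ, then k_p > 1, μ ≠ 0, ρ = σ and k_p·s_p > n_p. -/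

import Mathlib

open scoped Classical

noncomputable section

namespace ArXiv230800432

/-- The `σ`-part of a natural number: product of `p ^ vₚ(n)` over primes `p ∈ σ` dividing `n`. -/
def natPart (n : ℕ) (σ : Set ℕ) : ℕ :=
  ∏ p ∈ n.primeFactors, if p ∈ σ then p ^ (n.factorization p) else 1

/-- A metacyclic factorization `G = A·B` with `A` cyclic normal and `B` cyclic. -/
structure MetacyclicFact (G : Type*) [Group G] where
  A : Subgroup G
  B : Subgroup G
  normalA : A.Normal
  cyclicA : IsCyclic A
  cyclicB : IsCyclic B
  mul_cover : ∀ g : G, ∃ x ∈ A, ∃ y ∈ B, g = x * y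

/-- A group is metacyclic if it admits a metacyclic factorization. -/
def IsMetacyclic (G : Type*) [Group G] : Prop :=
  Nonempty (MetacyclicFact G)

variable {G : Type*} [Group G]

/-- `π_G`: primes `p` dividing `|G|` such that `G` has a normal Hall `p'`-subgroup. -/
def piSet (G : Type*) [Group G] : Set ℕ :=
  {p | p.Prime ∧ p ∣ Nat.card G ∧
    ∃ N : Subgroup G, N.Normal ∧ Nat.card N = ordCompl[p] (Nat.card G)}

/-- `π'_G = π(G) \ π_G`. -/
def piSet' (G : Type*) [Group G] : Set ℕ :=
  {p | p.Prime ∧ p ∣ Nat.card G} \ piSet G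

/-- The image mod `d` of `T_G(A)`: classes `[t]_d` such that some `g ∈ G` acts on `A` by
conjugation as `x ↦ x ^ t`.  For `d = |A|` this is exactly `T_G(A)`. -/
def TGmod (A : Subgroup G) (d : ℕ) : Subgroup (ZMod d)ˣ :=
  Subgroup.closure
    {u : (ZMod d)ˣ | ∃ g : G, ∃ t : ℕ, ((t : ZMod d) = (u : ZMod d)) ∧
      ∀ x ∈ A, g⁻¹ * x * g = x ^ t}

/-- `T_G(A)` as subgroup of `(ℤ/|A|ℤ)ˣ`. -/
def TG (A : Subgroup G) : Subgroup (ZMod (Nat.card A))ˣ :=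
  TGmod A (Nat.card A)

/-- The image of `T` under `Res_q : (ℤ/dℤ)ˣ → (ℤ/qℤ)ˣ` is trivial. -/
def resTriv (d q : ℕ) (T : Subgroup (ZMod d)ˣ) : Prop :=
  ∀ u ∈ T, ∀ t : ℕ, ((t : ZMod d) = (u : ZMod d)) → (t : ZMod q) = 1

/-- The image of `T` under `Res_q` is contained in `⟨-1⟩`. -/
def resInPMOne (d q : ℕ) (T : Subgroup (ZMod d)ˣ) : Prop :=
  ∀ u ∈ T, ∀ t : ℕ, ((t : ZMod d) = (u : ZMod d)) →
    ((t : ZMod q) = 1 ∨ (t : ZMod q) = -1)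

/-- The image of `T` under `Res_q` as a set of units mod `q`. -/
def resSet (d q : ℕ) (T : Subgroup (ZMod d)ˣ) : Set (ZMod q)ˣ :=
  {v | ∃ u ∈ T, ∃ t : ℕ, ((t : ZMod d) = (u : ZMod d)) ∧ ((t : ZMod q) = (v : ZMod q))}

/-- The set of natural numbers representing elements of `T ≤ (ℤ/dℤ)ˣ`. -/
def liftSet {d : ℕ} (T : Subgroup (ZMod d)ˣ) : Set ℕ :=
  {t | ∃ u ∈ T, (t : ZMod d) = (u : ZMod d)}

/-- `r^G(A)`: the greatest divisor `r` of `|A|` such that `Res_{r_{2'}}(T_G(A)) = 1` and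
`Res_{r_2}(T_G(A)) ⊆ ⟨-1⟩`. -/
def rOfA (A : Subgroup G) : ℕ :=
  sSup {r : ℕ | r ∣ Nat.card A ∧ resTriv (Nat.card A) (ordCompl[2] r) (TG A) ∧
    resInPMOne (Nat.card A) (ordProj[2] r) (TG A)}

/-- `ε^G(A)`: `-1` if `Res_{r_2}(T_G(A)) ≠ 1`, and `1` otherwise. -/
def epsOfA (A : Subgroup G) : ℤ :=
  if resTriv (Nat.card A) (ordProj[2] (rOfA A)) (TG A) then 1 else -1

/-- `k^G(A)`: order of the image of `T_G(A)` in `(ℤ/m_ν ℤ)ˣ`, `ν` the primes dividing `|A|`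
but not `r^G(A)`. -/
def kOfA (A : Subgroup G) : ℕ :=
  (resSet (Nat.card A) (natPart (Nat.card A) {p | ¬ p ∣ rOfA A}) (TG A)).ncard

/-- The triple `(|A|, r^G(A), [G:B])` attached to a metacyclic factorization. -/
def factTriple (f : MetacyclicFact G) : ℕ × ℕ × ℕ :=
  (Nat.card f.A, rOfA f.A, f.B.index)

/-- Lexicographic order on triples. -/
def lex3 (x y : ℕ × ℕ × ℕ) : Prop :=
  x.1 < y.1 ∨ (x.1 = y.1 ∧ (x.2.1 < y.2.1 ∨ (x.2.1 = y.2.1 ∧ x.2.2 ≤ y.2.2)))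

/-- A metacyclic factorization is minimal when its triple is lexicographically minimal. -/
def IsMinimalFact (f : MetacyclicFact G) : Prop :=
  ∀ f' : MetacyclicFact G, lex3 (factTriple f) (factTriple f')

def mOf (f : MetacyclicFact G) : ℕ := Nat.card f.A
def nOf (f : MetacyclicFact G) : ℕ := f.A.index
def sOf (f : MetacyclicFact G) : ℕ := f.B.index
def rOf (f : MetacyclicFact G) : ℕ := rOfA f.A
def epsOf (f : MetacyclicFact G) : ℤ := epsOfA f.A
def kOf (f : MetacyclicFact G) : ℕ := kOfA f.A

/-- The `σ`-part of an element of a finite group. -/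
def elemPart (σ : Set ℕ) (g : G) : G :=
  g ^ ((orderOf g / natPart (orderOf g) σ) *
    (((orderOf g / natPart (orderOf g) σ : ℕ) : ZMod (natPart (orderOf g) σ))⁻¹.val))

/-- The (unique, for `N` cyclic) Hall `σ`-subgroup of a subgroup `N`. -/
def hallOf (N : Subgroup G) (σ : Set ℕ) : Subgroup G :=
  Subgroup.closure {x : G | x ∈ N ∧ orderOf x ∣ natPart (Nat.card N) σ}

/-- `R^G = T_G(G'_{π'})`, realized as a subgroup of `(ℤ/dℤ)ˣ`. -/
def ROf (G : Type*) [Group G] (d : ℕ) : Subgroup (ZMod d)ˣ :=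
  TGmod (hallOf (commutator G) (piSet' G)) d

/-! ### Geometric sums -/

lemma geom_sum_mul_range (t m n : ℕ) :
    ∑ i ∈ Finset.range (m * n), t ^ i =
      (∑ i ∈ Finset.range m, t ^ i) * ∑ i ∈ Finset.range n, (t ^ m) ^ i := by
  induction n with
  | zero => simp
  | succ n ih =>
    rw [Nat.mul_succ, Finset.sum_range_add, ih, Finset.sum_range_succ, mul_add, ← pow_mul,
      Finset.sum_mul _ _ (t ^ (m * n))]
    congr 1
    exact Finset.sum_congr rfl fun i _ => by rw [pow_add, mul_comm]

/-- For `t ≡ 1` modulo `p` (modulo `4` if `p = 2`), the predicate that makes `1 + t + ⋯` behave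
well `p`-adically. -/
def NiceExp (p t : ℕ) : Prop := t ≡ 1 [MOD p] ∧ (p = 2 → t ≡ 1 [MOD 4])

lemma NiceExp.pow {p t : ℕ} (h : NiceExp p t) (j : ℕ) : NiceExp p (t ^ j) :=
  ⟨by simpa using h.1.pow j, fun h2 => by simpa using (h.2 h2).pow j⟩

lemma NiceExp.geom_sum_prime {p t : ℕ} (hp : p.Prime) (h : NiceExp p t) :
    ∃ u, ∑ i ∈ Finset.range p, t ^ i = p * u ∧ ¬ p ∣ u := by
  rcases hp.eq_two_or_odd' with rfl | hodd
  · have h4 := h.2 rfl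
    unfold Nat.ModEq at h4
    refine ⟨(1 + t) / 2, ?_, ?_⟩
    · simp [Finset.sum_range_succ]; omega
    · omega
  · obtain ⟨c, hc⟩ := (Nat.modEq_iff_dvd.1 h.1.symm)
    have h1 := odd_sq_dvd_geom_sum₂_sub (R := ℤ) (a := 1) (b := c) hodd
    simp only [one_pow, mul_one] at h1
    have ht : (1 + (p : ℤ) * c) = t := by push_cast at hc; linarith
    rw [ht] at h1
    obtain ⟨d, hd⟩ := h1
    have hS : ((∑ i ∈ Finset.range p, t ^ i : ℕ) : ℤ) = p * (1 + p * d) := by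
      push_cast; linarith
    have hpS : p ∣ ∑ i ∈ Finset.range p, t ^ i := by
      rw [← Int.natCast_dvd_natCast, hS]; exact dvd_mul_right _ _
    obtain ⟨u, hu⟩ := hpS
    refine ⟨u, hu, fun hpu => ?_⟩
    rw [hu] at hS
    push_cast at hS
    have hp0 : (p : ℤ) ≠ 0 := by exact_mod_cast hp.ne_zero
    have hu' := mul_left_cancel₀ hp0 hS
    have : (p : ℤ) ∣ 1 := by
      have h3 : (p : ℤ) ∣ u := by exact_mod_cast hpu
      rw [hu'] at h3
      exact (Int.dvd_add_left (dvd_mul_right _ _)).1 h3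
    exact hp.one_lt.ne' (by exact_mod_cast Int.eq_one_of_dvd_one (by positivity) this)

lemma NiceExp.geom_sum_pow {p t : ℕ} (hp : p.Prime) (h : NiceExp p t) (i : ℕ) :
    ∃ u, ∑ l ∈ Finset.range (p ^ i), t ^ l = p ^ i * u ∧ ¬ p ∣ u := by
  induction i with
  | zero => exact ⟨1, by simp, hp.one_lt.ne' ∘ Nat.dvd_one.1⟩
  | succ i ih =>
    obtain ⟨u, hu, hpu⟩ := ih
    obtain ⟨v, hv, hpv⟩ := (h.pow (p ^ i)).geom_sum_prime hp
    refine ⟨u * v, ?_, hp.not_dvd_mul hpu hpv⟩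
    rw [pow_succ, geom_sum_mul_range, hu, hv]
    ring

/-! ### Powers in a group with a cyclic normal subgroup -/

lemma conj_pow_exp {x y : G} {t : ℕ} (h : y⁻¹ * x * y = x ^ t) (j : ℕ) :
    (y ^ j)⁻¹ * x * y ^ j = x ^ t ^ j := by
  induction j with
  | zero => simp
  | succ j ih =>
    have : (y ^ (j + 1))⁻¹ * x * y ^ (j + 1) = y⁻¹ * ((y ^ j)⁻¹ * x * y ^ j) * y := by
      rw [pow_succ]; group
    rw [this, ih, pow_succ t, mul_comm, pow_mul, ← h]
    simpa using (conj_pow (i := t ^ j) (a := y⁻¹) (b := x)).symm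

lemma conj_pow_base {x y : G} {t : ℕ} (h : y⁻¹ * x * y = x ^ t) (k : ℕ) :
    y⁻¹ * x ^ k * y = (x ^ k) ^ t := by
  rw [← pow_mul, mul_comm, pow_mul, ← h]
  simpa using (conj_pow (i := k) (a := y⁻¹) (b := x)).symm

lemma mul_pow_of_conj {x y : G} {t : ℕ} (h : y⁻¹ * x * y = x ^ t) (n : ℕ) :
    (y * x) ^ n = y ^ n * x ^ ∑ i ∈ Finset.range n, t ^ i := by
  induction n with
  | zero => simp
  | succ n ih =>
    have h1 := conj_pow_base h (∑ i ∈ Finset.range n, t ^ i)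
    have h2 : x ^ (∑ i ∈ Finset.range n, t ^ i) * y =
        y * (x ^ ∑ i ∈ Finset.range n, t ^ i) ^ t := by rw [← h1]; group
    rw [pow_succ, ih, Finset.sum_range_succ', pow_add, pow_zero, pow_one, mul_assoc,
      ← mul_assoc _ y x, h2, pow_succ, ← pow_mul, Finset.sum_mul]
    simp only [pow_succ, mul_assoc]

lemma mul_pow_of_conj' {x y : G} {t : ℕ} (h : y⁻¹ * x * y = x ^ t) (j k n : ℕ) :
    (y ^ j * x ^ k) ^ n = y ^ (j * n) * x ^ (k * ∑ i ∈ Finset.range n, (t ^ j) ^ i) := by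
  rw [mul_pow_of_conj (conj_pow_base (conj_pow_exp h j) k), pow_mul, pow_mul]

lemma mul_pow_prime_pow_eq_one {x y : G} {p t : ℕ} (hp : p.Prime) (ht : NiceExp p t)
    (h : y⁻¹ * x * y = x ^ t) {i : ℕ} (hx : x ^ p ^ i = 1) (hy : y ^ p ^ i = 1) (j k : ℕ) :
    (y ^ j * x ^ k) ^ p ^ i = 1 := by
  obtain ⟨u, hu, -⟩ := (ht.pow j).geom_sum_pow hp i
  rw [mul_pow_of_conj' h, hu, mul_comm j, pow_mul, hy, mul_left_comm, pow_mul, hx]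
  simp

/-! ### Generators of a metacyclic factorization -/

/-- `a` and `b` generate the two factors of `f`, and `b` acts on `a` as raising to the `t`. -/
structure MetacyclicFact.IsGen (f : MetacyclicFact G) (a b : G) (t : ℕ) : Prop where
  A_eq : f.A = Subgroup.zpowers a
  B_eq : f.B = Subgroup.zpowers b
  one_le : 1 ≤ t
  conj : b⁻¹ * a * b = a ^ t

lemma exists_nat_pow_of_mem_zpowers [Finite G] {x y : G} (h : y ∈ Subgroup.zpowers x) :
    ∃ n : ℕ, y = x ^ n := by
  obtain ⟨n, hn⟩ := mem_powers_iff_mem_zpowers.2 h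
  exact ⟨n, hn.symm⟩

lemma MetacyclicFact.exists_isGen [Finite G] (f : MetacyclicFact G) :
    ∃ a b t, f.IsGen a b t := by
  obtain ⟨a, ha⟩ := (Subgroup.isCyclic_iff_exists_zpowers_eq_top f.A).1 f.cyclicA
  obtain ⟨b, hb⟩ := (Subgroup.isCyclic_iff_exists_zpowers_eq_top f.B).1 f.cyclicB
  have hmem : b⁻¹ * a * b ∈ Subgroup.zpowers a := by
    rw [ha]
    have h1 : a ∈ f.A := ha ▸ Subgroup.mem_zpowers a
    simpa using f.normalA.conj_mem a h1 b⁻¹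
  obtain ⟨n, hn⟩ := exists_nat_pow_of_mem_zpowers hmem
  refine ⟨a, b, n + Nat.card G, ha.symm, hb.symm, ?_, ?_⟩
  · have := Nat.card_pos (α := G); omega
  · rw [hn, pow_add, pow_card_eq_one', mul_one]

lemma natPart_dvd {n : ℕ} (hn : n ≠ 0) (σ : Set ℕ) : natPart n σ ∣ n := by
  conv_rhs => rw [← Nat.prod_factorization_pow_eq_self hn]
  refine Finset.prod_dvd_prod_of_dvd _ _ fun p _ => ?_
  split_ifs
  · exact dvd_rfl
  · exact one_dvd _

namespace MetacyclicFact.IsGen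

variable [Finite G] {f : MetacyclicFact G} {a b : G} {t : ℕ}

lemma cover (h : f.IsGen a b t) (g : G) : ∃ i j : ℕ, g = a ^ i * b ^ j := by
  obtain ⟨x, hx, y, hy, rfl⟩ := f.mul_cover g
  rw [h.A_eq] at hx
  rw [h.B_eq] at hy
  obtain ⟨i, rfl⟩ := exists_nat_pow_of_mem_zpowers hx
  obtain ⟨j, rfl⟩ := exists_nat_pow_of_mem_zpowers hy
  exact ⟨i, j, rfl⟩

lemma cover' (h : f.IsGen a b t) (g : G) : ∃ i j : ℕ, g = b ^ j * a ^ i := by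
  obtain ⟨i, j, hij⟩ := h.cover g⁻¹
  obtain ⟨k, hk⟩ := exists_nat_pow_of_mem_zpowers
    (Subgroup.inv_mem _ (Subgroup.npow_mem_zpowers a i))
  obtain ⟨l, hl⟩ := exists_nat_pow_of_mem_zpowers
    (Subgroup.inv_mem _ (Subgroup.npow_mem_zpowers b j))
  exact ⟨k, l, by rw [← inv_inv g, hij, mul_inv_rev, hk, hl]⟩

omit [Finite G] in
lemma mOf_eq (h : f.IsGen a b t) : mOf f = orderOf a := by
  rw [mOf, h.A_eq, Nat.card_zpowers]

lemma coprime (h : f.IsGen a b t) : t.Coprime (Nat.card f.A) := by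
  rw [show Nat.card f.A = orderOf a from h.mOf_eq]
  have h1 : orderOf (a ^ t) = orderOf a := by
    rw [← h.conj]
    have h2 := orderOf_injective (MulAut.conj (b⁻¹)).toMonoidHom
      (MulAut.conj (b⁻¹)).injective a
    simpa using h2
  rw [orderOf_pow' _ (by have := h.one_le; omega)] at h1
  have h2 := Nat.div_mul_cancel (Nat.gcd_dvd_left (orderOf a) t)
  rw [h1] at h2
  have h3 := orderOf_pos a
  rw [Nat.coprime_comm]
  exact Nat.eq_of_mul_eq_mul_left h3 (by rw [h2, mul_one])

omit [Finite G] in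
lemma conj_word (h : f.IsGen a b t) (i j : ℕ) :
    (a ^ i * b ^ j)⁻¹ * a * (a ^ i * b ^ j) = a ^ t ^ j := by
  rw [← conj_pow_exp h.conj j, mul_inv_rev]
  have : (a ^ i)⁻¹ * a * a ^ i = a := by
    rw [mul_assoc, ← pow_succ', pow_succ, inv_mul_cancel_left]
  calc (b ^ j)⁻¹ * (a ^ i)⁻¹ * a * (a ^ i * b ^ j)
      = (b ^ j)⁻¹ * ((a ^ i)⁻¹ * a * a ^ i) * b ^ j := by group
    _ = _ := by rw [this]

lemma TG_eq (h : f.IsGen a b t) : TG f.A = Subgroup.zpowers (ZMod.unitOfCoprime t h.coprime) := by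
  have hm : Nat.card f.A = orderOf a := h.mOf_eq
  have ha : a ∈ f.A := h.A_eq ▸ Subgroup.mem_zpowers a
  refine le_antisymm ?_ ?_
  · refine (Subgroup.closure_le _).2 ?_
    rintro u ⟨g, s, hs, hg⟩
    obtain ⟨i, j, rfl⟩ := h.cover g
    refine ⟨j, ?_⟩
    have h1 := (hg a ha).symm.trans (h.conj_word i j)
    rw [pow_eq_pow_iff_modEq, ← hm, ← ZMod.natCast_eq_natCast_iff] at h1
    refine Units.ext ?_
    rw [← hs, h1]
    simp
  · rw [Subgroup.zpowers_le]
    refine Subgroup.subset_closure ⟨b, t, rfl, fun x hx => ?_⟩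
    rw [h.A_eq] at hx
    obtain ⟨i, rfl⟩ := exists_nat_pow_of_mem_zpowers hx
    exact conj_pow_base h.conj i

omit [Finite G] in
lemma castHom_eq {d q : ℕ} (hq : q ∣ d) {u : (ZMod d)ˣ} {s : ℕ} (hs : (s : ZMod d) = u) :
    ((ZMod.unitsMap hq u : (ZMod q)ˣ) : ZMod q) = s := by
  rw [ZMod.unitsMap_val, ← hs, ZMod.cast_natCast hq]

lemma resTriv_iff (h : f.IsGen a b t) {q : ℕ} (hq : q ∣ Nat.card f.A) :
    resTriv (Nat.card f.A) q (TG f.A) ↔ q ∣ t - 1 := by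
  rw [← Nat.modEq_iff_dvd' h.one_le, Nat.ModEq.comm, ← ZMod.natCast_eq_natCast_iff, Nat.cast_one,
    h.TG_eq]
  constructor
  · intro H
    exact H _ (Subgroup.mem_zpowers _) t rfl
  · rintro H u ⟨j, rfl⟩ s hs
    rw [← castHom_eq hq hs]
    have : ZMod.unitsMap hq (ZMod.unitOfCoprime t h.coprime) = 1 := by
      refine Units.ext ?_
      rw [castHom_eq hq (s := t) rfl, H]; rfl
    simp [map_zpow, this]

lemma resInPMOne_iff (h : f.IsGen a b t) {q : ℕ} (hq : q ∣ Nat.card f.A) :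
    resInPMOne (Nat.card f.A) q (TG f.A) ↔ q ∣ t - 1 ∨ q ∣ t + 1 := by
  have e1 : q ∣ t - 1 ↔ (t : ZMod q) = 1 := by
    rw [← Nat.modEq_iff_dvd' h.one_le, Nat.ModEq.comm, ← ZMod.natCast_eq_natCast_iff,
      Nat.cast_one]
  have e2 : q ∣ t + 1 ↔ (t : ZMod q) = -1 := by
    rw [← ZMod.natCast_eq_zero_iff, Nat.cast_add, Nat.cast_one, eq_neg_iff_add_eq_zero]
  rw [e1, e2, h.TG_eq]
  constructor
  · intro H
    exact H _ (Subgroup.mem_zpowers _) t rfl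
  · rintro H u ⟨j, rfl⟩ s hs
    rw [← castHom_eq hq hs]
    rcases H with H | H
    · left
      have : ZMod.unitsMap hq (ZMod.unitOfCoprime t h.coprime) = 1 := by
        refine Units.ext ?_
        rw [castHom_eq hq (s := t) rfl, H]; rfl
      simp only [map_zpow, this]
      simp
    · have : ZMod.unitsMap hq (ZMod.unitOfCoprime t h.coprime) = -1 := by
        refine Units.ext ?_
        rw [castHom_eq hq (s := t) rfl, H]; rfl
      simp only [map_zpow, this]
      rcases Int.even_or_odd j with hj | hj
      · left; rw [hj.neg_one_zpow]; rfl
      · right; rw [hj.neg_one_zpow]; rfl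

lemma kOf_dvd_iff (h : f.IsGen a b t) (n : ℕ) :
    kOf f ∣ n ↔ natPart (mOf f) {p | ¬ p ∣ rOf f} ∣ t ^ n - 1 := by
  have hq : natPart (Nat.card f.A) {p | ¬ p ∣ rOfA f.A} ∣ Nat.card f.A :=
    natPart_dvd Nat.card_pos.ne' _
  change (resSet _ _ _).ncard ∣ n ↔ natPart (Nat.card f.A) {p | ¬ p ∣ rOfA f.A} ∣ _
  generalize natPart (Nat.card f.A) {p | ¬ p ∣ rOfA f.A} = q at *
  have hset : resSet (Nat.card f.A) q (TG f.A) =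
      Subgroup.zpowers (ZMod.unitsMap hq (ZMod.unitOfCoprime t h.coprime)) := by
    rw [h.TG_eq, ← MonoidHom.map_zpowers]
    ext v
    constructor
    · rintro ⟨u, hu, s, hs, hv⟩
      exact ⟨u, hu, Units.ext (by rw [castHom_eq hq hs, hv])⟩
    · rintro ⟨u, hu, rfl⟩
      have hs : (((u : ZMod (Nat.card f.A)).val : ℕ) : ZMod (Nat.card f.A)) = u :=
        ZMod.natCast_zmod_val _
      exact ⟨u, hu, _, hs, (castHom_eq hq hs).symm⟩
  rw [hset, ← Nat.card_coe_set_eq]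
  erw [Nat.card_zpowers]
  rw [orderOf_dvd_iff_pow_eq_one, ← Nat.modEq_iff_dvd' (Nat.one_le_pow _ _ h.one_le),
    Nat.ModEq.comm, ← ZMod.natCast_eq_natCast_iff, ← map_pow, Units.ext_iff,
    castHom_eq hq (s := t ^ n) (by simp)]
  simp

end MetacyclicFact.IsGen

/-! ### The invariant `r` -/

lemma pow_dvd_ordProj_of_dvd {p n i : ℕ} (hp : p.Prime) (hn : n ≠ 0) (h : p ^ i ∣ n) :
    p ^ i ∣ ordProj[p] n :=
  pow_dvd_pow _ ((hp.pow_dvd_iff_le_factorization hn).1 h)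

lemma ordCompl_dvd_of_dvd_mul {p n i k : ℕ} (hp : p.Prime) (hn : n ≠ 0) (h : n ∣ p ^ i * k) :
    ordCompl[p] n ∣ k := by
  have h1 : (ordCompl[p] n).Coprime (p ^ i) :=
    ((Nat.coprime_ordCompl hp hn).symm).pow_right _
  exact h1.dvd_of_dvd_mul_left ((Nat.ordCompl_dvd n p).trans h)

namespace MetacyclicFact.IsGen

variable [Finite G] {f : MetacyclicFact G} {a b : G} {t : ℕ}

lemma mem_rOf_set (h : f.IsGen a b t) (r : ℕ) :
    (r ∣ Nat.card f.A ∧ resTriv (Nat.card f.A) (ordCompl[2] r) (TG f.A) ∧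
      resInPMOne (Nat.card f.A) (ordProj[2] r) (TG f.A)) ↔
    (r ∣ mOf f ∧ ordCompl[2] r ∣ t - 1 ∧ (ordProj[2] r ∣ t - 1 ∨ ordProj[2] r ∣ t + 1)) := by
  refine and_congr_right fun hr => ?_
  rw [h.resTriv_iff ((Nat.ordCompl_dvd r 2).trans hr),
    h.resInPMOne_iff ((Nat.ordProj_dvd r 2).trans hr)]

lemma rOf_spec (h : f.IsGen a b t) : rOf f ∣ mOf f ∧ ordCompl[2] (rOf f) ∣ t - 1 ∧
    (ordProj[2] (rOf f) ∣ t - 1 ∨ ordProj[2] (rOf f) ∣ t + 1) := by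
  rw [← h.mem_rOf_set]
  refine Nat.sSup_mem (s := {r : ℕ | r ∣ Nat.card f.A ∧
    resTriv (Nat.card f.A) (ordCompl[2] r) (TG f.A) ∧
    resInPMOne (Nat.card f.A) (ordProj[2] r) (TG f.A)})
    ⟨1, (h.mem_rOf_set 1).2 (by simp)⟩ ⟨Nat.card f.A, fun r hr => Nat.le_of_dvd Nat.card_pos hr.1⟩

lemma mOf_ne_zero (h : f.IsGen a b t) : mOf f ≠ 0 := by
  rw [h.mOf_eq]; exact (orderOf_pos a).ne'

lemma rOf_ne_zero (h : f.IsGen a b t) : rOf f ≠ 0 :=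
  ne_zero_of_dvd_ne_zero h.mOf_ne_zero h.rOf_spec.1

lemma dvd_rOf_of_lcm (h : f.IsGen a b t) {k : ℕ} (hk : k ∣ mOf f)
    (h1 : ordCompl[2] ((rOf f).lcm k) ∣ t - 1)
    (h2 : ordProj[2] ((rOf f).lcm k) ∣ t - 1 ∨ ordProj[2] ((rOf f).lcm k) ∣ t + 1) :
    k ∣ rOf f := by
  have hle : (rOf f).lcm k ≤ rOf f :=
    le_csSup (s := {r : ℕ | r ∣ Nat.card f.A ∧
      resTriv (Nat.card f.A) (ordCompl[2] r) (TG f.A) ∧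
      resInPMOne (Nat.card f.A) (ordProj[2] r) (TG f.A)})
      ⟨Nat.card f.A, fun r hr => Nat.le_of_dvd Nat.card_pos hr.1⟩
      ((h.mem_rOf_set _).2 ⟨Nat.lcm_dvd h.rOf_spec.1 hk, h1, h2⟩)
  have hdvd := Nat.dvd_lcm_left (rOf f) k
  have hk0 : k ≠ 0 := ne_zero_of_dvd_ne_zero h.mOf_ne_zero hk
  have heq : (rOf f).lcm k = rOf f :=
    le_antisymm hle (Nat.le_of_dvd (Nat.lcm_pos (Nat.pos_of_ne_zero h.rOf_ne_zero)
      (Nat.pos_of_ne_zero hk0)) hdvd)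
  rw [← heq]
  exact Nat.dvd_lcm_right _ _

lemma odd_pow_dvd_rOf (h : f.IsGen a b t) {p i : ℕ} (hp : p.Prime) (hp2 : p ≠ 2)
    (hm : p ^ i ∣ mOf f) (ht : p ^ i ∣ t - 1) : p ^ i ∣ rOf f := by
  obtain ⟨-, hr1, hr2⟩ := h.rOf_spec
  have hpi : p ^ i ≠ 0 := pow_ne_zero _ hp.ne_zero
  have hr0 := h.rOf_ne_zero
  refine h.dvd_rOf_of_lcm hm ?_ ?_
  · refine (ordCompl_dvd_of_dvd_mul (i := (rOf f).factorization 2)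
      (k := (ordCompl[2] (rOf f)).lcm (p ^ i)) Nat.prime_two (Nat.lcm_ne_zero hr0 hpi)
      ?_).trans (Nat.lcm_dvd hr1 ht)
    refine Nat.lcm_dvd ?_ ((Nat.dvd_lcm_right _ _).mul_left _)
    conv_lhs => rw [← Nat.ordProj_mul_ordCompl_eq_self (rOf f) 2]
    exact mul_dvd_mul_left _ (Nat.dvd_lcm_left _ _)
  · have : ((rOf f).lcm (p ^ i)).factorization 2 = (rOf f).factorization 2 := by
      rw [Nat.factorization_lcm hr0 hpi, Finsupp.sup_apply, hp.factorization_pow]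
      simp [hp2]
    rw [this]
    exact hr2

lemma two_pow_dvd_rOf (h : f.IsGen a b t) {i : ℕ}
    (hm : 2 ^ i ∣ mOf f) (ht : 2 ^ i ∣ t - 1 ∨ 2 ^ i ∣ t + 1) : 2 ^ i ∣ rOf f := by
  obtain ⟨-, hr1, -⟩ := h.rOf_spec
  have hpi : 2 ^ i ≠ 0 := pow_ne_zero _ two_ne_zero
  have hr0 := h.rOf_ne_zero
  by_cases hi : i ≤ (rOf f).factorization 2
  · exact (Nat.prime_two.pow_dvd_iff_le_factorization hr0).2 hi
  refine h.dvd_rOf_of_lcm hm ?_ ?_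
  · refine (ordCompl_dvd_of_dvd_mul (i := (rOf f).factorization 2 + i)
      (k := (ordCompl[2] (rOf f))) Nat.prime_two (Nat.lcm_ne_zero hr0 hpi) ?_).trans hr1
    rw [pow_add]
    refine Nat.lcm_dvd ?_ (Dvd.intro_left _ rfl |>.mul_right _)
    conv_lhs => rw [← Nat.ordProj_mul_ordCompl_eq_self (rOf f) 2]
    exact mul_dvd_mul_right (dvd_mul_right _ _) _
  · have : ((rOf f).lcm (2 ^ i)).factorization 2 = i := by
      rw [Nat.factorization_lcm hr0 hpi, Finsupp.sup_apply, Nat.prime_two.factorization_pow]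
      simp; omega
    rw [this]
    exact ht

lemma ordProj_dvd_of_epsOf (h : f.IsGen a b t) : epsOf f = 1 ↔ ordProj[2] (rOf f) ∣ t - 1 := by
  rw [← h.resTriv_iff ((Nat.ordProj_dvd _ _).trans h.rOf_spec.1)]
  change (if resTriv (Nat.card f.A) (ordProj[2] (rOf f)) (TG f.A) then (1 : ℤ) else -1) = 1 ↔ _
  split_ifs with hc
  · simpa using hc
  · simpa using hc

lemma pow_dvd_rOf_iff (h : f.IsGen a b t) {p : ℕ} (hp : p.Prime) (he : p ≠ 2 ∨ epsOf f = 1)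
    (i : ℕ) : p ^ i ∣ rOf f ↔ p ^ i ∣ mOf f ∧ p ^ i ∣ t - 1 := by
  constructor
  · intro hi
    refine ⟨hi.trans h.rOf_spec.1, ?_⟩
    by_cases hp2 : p = 2
    · subst hp2
      exact (pow_dvd_ordProj_of_dvd hp h.rOf_ne_zero hi).trans
        (h.ordProj_dvd_of_epsOf.1 (by simpa using he))
    · have hcop : (p ^ i).Coprime (ordProj[2] (rOf f)) :=
        Nat.Coprime.pow _ _ ((Nat.coprime_primes hp Nat.prime_two).2 hp2)
      refine (hcop.dvd_of_dvd_mul_left ?_).trans h.rOf_spec.2.1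
      rwa [Nat.ordProj_mul_ordCompl_eq_self]
  · rintro ⟨h1, h2⟩
    by_cases hp2 : p = 2
    · subst hp2
      exact h.two_pow_dvd_rOf h1 (Or.inl h2)
    · exact h.odd_pow_dvd_rOf hp hp2 h1 h2

lemma ordProj_rOf (h : f.IsGen a b t) {p : ℕ} (hp : p.Prime) (he : p ≠ 2 ∨ epsOf f = 1) :
    ordProj[p] (rOf f) = (ordProj[p] (mOf f)).gcd (t - 1) := by
  refine Nat.dvd_antisymm ?_ ?_
  · have := (h.pow_dvd_rOf_iff hp he _).1 (Nat.ordProj_dvd (rOf f) p)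
    exact Nat.dvd_gcd (pow_dvd_ordProj_of_dvd hp h.mOf_ne_zero this.1) this.2
  · obtain ⟨i, -, hi⟩ := (Nat.dvd_prime_pow hp).1 (Nat.gcd_dvd_left (ordProj[p] (mOf f)) (t - 1))
    rw [hi]
    refine pow_dvd_ordProj_of_dvd hp h.rOf_ne_zero ((h.pow_dvd_rOf_iff hp he _).2 ?_)
    rw [← hi]
    exact ⟨(Nat.gcd_dvd_left _ _).trans (Nat.ordProj_dvd _ _), Nat.gcd_dvd_right _ _⟩

end MetacyclicFact.IsGen

/-! ### Quotients by normal Hall `p'`-subgroups -/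

lemma ordProj_eq_of_mul {p i c : ℕ} (hp : p.Prime) (hc : p.Coprime c) :
    ordProj[p] (p ^ i * c) = p ^ i := by
  have hc0 : c ≠ 0 := by
    rintro rfl
    exact hp.one_lt.ne' (by simpa using hc)
  rw [Nat.factorization_mul (pow_ne_zero _ hp.ne_zero) hc0, Finsupp.add_apply,
    Nat.factorization_eq_zero_of_not_dvd ((hp.coprime_iff_not_dvd).1 hc)]
  simp [hp.factorization_pow]

/-- `φ` is a surjection onto a `p`-group whose kernel has order prime to `p`. -/
structure IsPQuot {P : Type*} [Group P] (p : ℕ) (φ : G →* P) : Prop where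
  prime : p.Prime
  surj : Function.Surjective φ
  isPGroup : IsPGroup p P
  coprime : p.Coprime (Nat.card φ.ker)

namespace IsPQuot

variable {P : Type*} [Group P] [Finite G] {p : ℕ} {φ : G →* P}

omit [Finite G] in
lemma id_of_isPGroup (hp : p.Prime) (h : IsPGroup p G) : IsPQuot p (MonoidHom.id G) where
  prime := hp
  surj := Function.surjective_id
  isPGroup := h
  coprime := by simp [(MonoidHom.ker_eq_bot_iff (MonoidHom.id G)).2 Function.injective_id]

lemma finite (h : IsPQuot p φ) : Finite P := Finite.of_surjective φ h.surj

lemma exists_card_subgroup (h : IsPQuot p φ) (K : Subgroup P) : ∃ i, Nat.card K = p ^ i := by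
  have := h.finite
  have : Fact p.Prime := ⟨h.prime⟩
  exact IsPGroup.iff_card.1 (h.isPGroup.to_subgroup K)

lemma exists_orderOf (h : IsPQuot p φ) (x : P) : ∃ i, orderOf x = p ^ i := by
  rw [← Nat.card_zpowers]
  exact h.exists_card_subgroup _

omit [Finite G] in
lemma card_map_mul (_h : IsPQuot p φ) (H : Subgroup G) :
    ∃ c, c ∣ Nat.card φ.ker ∧ Nat.card (H.map φ) * c = Nat.card H := by
  refine ⟨Nat.card (φ.ker.subgroupOf H), ?_, ?_⟩
  · rw [← Subgroup.card_map_of_injective H.subtype_injective, Subgroup.subgroupOf_map_subtype]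
    exact Subgroup.card_dvd_of_le inf_le_left
  · rw [← Subgroup.relIndex_ker, mul_comm]
    exact Subgroup.card_mul_index _

lemma card_map (h : IsPQuot p φ) (H : Subgroup G) :
    Nat.card (H.map φ) = ordProj[p] (Nat.card H) := by
  obtain ⟨c, hc, hc'⟩ := h.card_map_mul H
  obtain ⟨i, hi⟩ := h.exists_card_subgroup (H.map φ)
  rw [← hc', hi, ordProj_eq_of_mul h.prime (h.coprime.coprime_dvd_right hc)]

lemma card_eq (h : IsPQuot p φ) : Nat.card P = ordProj[p] (Nat.card G) := by
  rw [← Subgroup.card_top (G := G), ← h.card_map, Subgroup.map_top_of_surjective _ h.surj,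
    Subgroup.card_top]

lemma index_map (h : IsPQuot p φ) (H : Subgroup G) :
    (H.map φ).index = ordProj[p] H.index := by
  have h1 := Subgroup.card_mul_index (H.map φ)
  rw [h.card_map, h.card_eq, ← Subgroup.card_mul_index H,
    Nat.ordProj_mul p Nat.card_pos.ne' Subgroup.index_ne_zero_of_finite] at h1
  exact Nat.eq_of_mul_eq_mul_left (Nat.ordProj_pos _ _) h1

lemma orderOf_eq (h : IsPQuot p φ) (x : G) : orderOf (φ x) = ordProj[p] (orderOf x) := by
  rw [← Nat.card_zpowers, ← Nat.card_zpowers, ← h.card_map, MonoidHom.map_zpowers]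

omit [Finite G] in
lemma eq_one_of_pow (h : IsPQuot p φ) {x : G} (hx : φ x = 1) {i : ℕ} (hi : x ^ p ^ i = 1) :
    x = 1 := by
  rw [← orderOf_eq_one_iff]
  have h1 : orderOf x ∣ Nat.card φ.ker := by
    rw [← Nat.card_zpowers]
    exact Subgroup.card_dvd_of_le (by rwa [Subgroup.zpowers_le])
  exact Nat.Coprime.eq_one_of_dvd
    (((h.coprime.pow_left i).coprime_dvd_right h1).symm) (orderOf_dvd_of_pow_eq_one hi)

lemma exists_lift (h : IsPQuot p φ) (x : G) :
    ∃ n : ℕ, φ (x ^ n) = φ x ∧ orderOf (x ^ n) = orderOf (φ x) := by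
  have hcop : (orderOf (φ x)).Coprime (ordCompl[p] (orderOf x)) := by
    rw [h.orderOf_eq]
    exact (Nat.coprime_ordCompl h.prime (orderOf_pos x).ne').pow_left _
  obtain ⟨n, hn1, hn2⟩ := Nat.chineseRemainder hcop 1 0
  have h1 : φ (x ^ n) = φ x := by
    rw [map_pow]
    conv_rhs => rw [← pow_one (φ x)]
    exact pow_eq_pow_iff_modEq.2 hn1
  refine ⟨n, h1, Nat.dvd_antisymm ?_ ?_⟩
  · apply orderOf_dvd_of_pow_eq_one
    rw [← pow_mul, ← orderOf_dvd_iff_pow_eq_one, h.orderOf_eq,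
      ← Nat.ordProj_mul_ordCompl_eq_self (orderOf x) p, mul_comm n]
    refine mul_dvd_mul ?_ (Nat.modEq_zero_iff_dvd.1 hn2)
    rw [Nat.ordProj_mul_ordCompl_eq_self]
  · conv_lhs => rw [← h1]
    exact orderOf_map_dvd φ _

omit [Finite G] in
lemma pow_eq_pow {x : G} (hx : orderOf x = orderOf (φ x)) {i j : ℕ}
    (hij : φ x ^ i = φ x ^ j) : x ^ i = x ^ j := by
  rw [pow_eq_pow_iff_modEq] at hij ⊢
  rwa [hx]

end IsPQuot

namespace MetacyclicFact

/-- The image of a metacyclic factorization under a surjective homomorphism. -/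
def map {P : Type*} [Group P] (f : MetacyclicFact G) (φ : G →* P) (h : Function.Surjective φ) :
    MetacyclicFact P where
  A := f.A.map φ
  B := f.B.map φ
  normalA := f.normalA.map φ h
  cyclicA := by
    have := f.cyclicA
    exact isCyclic_of_surjective (φ.subgroupMap f.A) (φ.subgroupMap_surjective f.A)
  cyclicB := by
    have := f.cyclicB
    exact isCyclic_of_surjective (φ.subgroupMap f.B) (φ.subgroupMap_surjective f.B)
  mul_cover g := by
    obtain ⟨x, rfl⟩ := h g
    obtain ⟨y, hy, z, hz, rfl⟩ := f.mul_cover x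
    exact ⟨φ y, Subgroup.mem_map_of_mem _ hy, φ z, Subgroup.mem_map_of_mem _ hz, map_mul _ _ _⟩

section

variable {P : Type*} [Group P] {p : ℕ} {φ : G →* P}

lemma IsGen.map {f : MetacyclicFact G} {a b : G} {t : ℕ} (h : f.IsGen a b t)
    (hφ : Function.Surjective φ) : (f.map φ hφ).IsGen (φ a) (φ b) t where
  A_eq := by change f.A.map φ = _; rw [h.A_eq, MonoidHom.map_zpowers]
  B_eq := by change f.B.map φ = _; rw [h.B_eq, MonoidHom.map_zpowers]
  one_le := h.one_le
  conj := by rw [← map_inv, ← map_mul, ← map_mul, h.conj, map_pow]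

variable [Finite G] (f : MetacyclicFact G)

lemma mOf_map (h : IsPQuot p φ) : mOf (f.map φ h.surj) = ordProj[p] (mOf f) := h.card_map _
lemma nOf_map (h : IsPQuot p φ) : nOf (f.map φ h.surj) = ordProj[p] (nOf f) := h.index_map _
lemma sOf_map (h : IsPQuot p φ) : sOf (f.map φ h.surj) = ordProj[p] (sOf f) := h.index_map _

omit [Finite G] in
lemma A_sup_B : f.A ⊔ f.B = ⊤ := by
  refine eq_top_iff.2 fun g _ => ?_
  obtain ⟨x, hx, y, hy, rfl⟩ := f.mul_cover g
  exact mul_mem (Subgroup.mem_sup_left hx) (Subgroup.mem_sup_right hy)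

omit [Finite G] in
lemma card_inf_mul_nOf : Nat.card (f.A ⊓ f.B : Subgroup G) * nOf f = Nat.card f.B := by
  have := f.normalA
  have h1 : f.A.relIndex f.B = f.A.index := by
    rw [← Subgroup.relIndex_sup_left (H := f.B) (K := f.A), f.A_sup_B, Subgroup.relIndex_top_right]
  rw [nOf, ← h1, ← Subgroup.inf_relIndex_right]
  have := Subgroup.card_mul_index ((f.A ⊓ f.B).subgroupOf f.B)
  rwa [Nat.card_congr (Subgroup.subgroupOfEquivOfLe inf_le_right).toEquiv] at this

omit [Finite G] in
lemma mOf_mul_nOf : mOf f * nOf f = Nat.card G := Subgroup.card_mul_index _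

omit [Finite G] in
lemma card_B_mul_sOf : Nat.card f.B * sOf f = Nat.card G := Subgroup.card_mul_index _

lemma card_inf_mul_sOf : Nat.card (f.A ⊓ f.B : Subgroup G) * sOf f = mOf f := by
  have hn : 0 < nOf f := Nat.pos_of_ne_zero Subgroup.index_ne_zero_of_finite
  refine Nat.eq_of_mul_eq_mul_right hn ?_
  rw [f.mOf_mul_nOf, mul_right_comm, f.card_inf_mul_nOf, f.card_B_mul_sOf]

end

end MetacyclicFact

/-! ### Commutators and exponents -/

lemma normal_zpowers_of_forall_conj_mem {x : G} (h : ∀ g : G, g⁻¹ * x * g ∈ Subgroup.zpowers x) :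
    (Subgroup.zpowers x).Normal := by
  refine ⟨fun n hn g => ?_⟩
  obtain ⟨k, rfl⟩ := hn
  have h1 := h g⁻¹
  rw [inv_inv] at h1
  simpa [conj_zpow] using Subgroup.zpow_mem _ h1 k

lemma orderOf_le_mul_orderOf_pow [Finite G] (x : G) {n : ℕ} (hn : n ≠ 0) :
    orderOf x ≤ n * orderOf (x ^ n) := by
  refine Nat.le_of_dvd (Nat.mul_pos (Nat.pos_of_ne_zero hn) (orderOf_pos _)) ?_
  exact orderOf_dvd_of_pow_eq_one (by rw [pow_mul, pow_orderOf_eq_one])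

lemma orderOf_le_card_of_mem [Finite G] {x : G} {H : Subgroup G} (hx : x ∈ H) :
    orderOf x ≤ Nat.card H := by
  rw [← Nat.card_zpowers]
  exact Subgroup.card_le_of_le (by rwa [Subgroup.zpowers_le])

lemma mem_of_zpow_mem {x : G} {H : Subgroup G} {c : ℤ} (hc : IsCoprime c (orderOf x : ℤ))
    (h : x ^ c ∈ H) : x ∈ H := by
  obtain ⟨u, v, huv⟩ := hc
  have : x = (x ^ c) ^ u := by
    conv_lhs => rw [← zpow_one x, ← huv, zpow_add, mul_comm u, zpow_mul, mul_comm v, zpow_mul,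
      zpow_natCast, pow_orderOf_eq_one, one_zpow, mul_one]
  rw [this]
  exact H.zpow_mem h u

namespace MetacyclicFact.IsGen

variable [Finite G] {f : MetacyclicFact G} {a b : G} {t : ℕ}

lemma normal_zpowers_pow (h : f.IsGen a b t) (k : ℕ) : (Subgroup.zpowers (a ^ k)).Normal := by
  refine normal_zpowers_of_forall_conj_mem fun g => ?_
  obtain ⟨i, j, rfl⟩ := h.cover g
  rw [conj_pow_base (h.conj_word i j)]
  exact Subgroup.npow_mem_zpowers _ _

open scoped commutatorElement in
lemma commutator_eq (h : f.IsGen a b t) : commutator G = Subgroup.zpowers (a ^ (t - 1)) := by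
  have hcomm : ⁅a⁻¹, b⁻¹⁆ = a ^ (t - 1) := by
    have h1 : a ^ t = a * a ^ (t - 1) := by
      rw [← pow_succ', Nat.sub_add_cancel h.one_le]
    rw [commutatorElement_def, inv_inv, inv_inv, mul_assoc, mul_assoc, ← mul_assoc b⁻¹, h.conj, h1,
      inv_mul_cancel_left]
  refine le_antisymm ?_ ?_
  · have := h.normal_zpowers_pow (t - 1)
    have hab : Commute (a : G ⧸ Subgroup.zpowers (a ^ (t - 1))) (b : G ⧸ _) := by
      rw [← Commute.inv_left_iff, ← Commute.inv_right_iff, ← commutatorElement_eq_one_iff_commute]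
      have h1 : ((⁅a⁻¹, b⁻¹⁆ : G) : G ⧸ Subgroup.zpowers (a ^ (t - 1))) = 1 := by
        rw [QuotientGroup.eq_one_iff, hcomm]
        exact Subgroup.mem_zpowers _
      exact h1
    rw [commutator_def, Subgroup.commutator_le]
    intro g _ g' _
    obtain ⟨i, j, rfl⟩ := h.cover g
    obtain ⟨k, l, rfl⟩ := h.cover g'
    rw [← QuotientGroup.eq_one_iff]
    change ⁅((a ^ i * b ^ j : G) : G ⧸ Subgroup.zpowers (a ^ (t - 1))),
      ((a ^ k * b ^ l : G) : G ⧸ Subgroup.zpowers (a ^ (t - 1)))⁆ = 1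
    rw [commutatorElement_eq_one_iff_commute]
    simp only [QuotientGroup.mk_mul, QuotientGroup.mk_pow]
    exact (((Commute.refl _).pow_pow _ _).mul_right (hab.pow_pow _ _)).mul_left
      ((hab.symm.pow_pow _ _).mul_right ((Commute.refl _).pow_pow _ _))
  · rw [Subgroup.zpowers_le, ← hcomm, commutator_def]
    exact Subgroup.commutator_mem_commutator (Subgroup.mem_top _) (Subgroup.mem_top _)

lemma card_commutator (h : f.IsGen a b t) :
    Nat.card (commutator G) * (mOf f).gcd (t - 1) = mOf f := by
  rw [h.commutator_eq, Nat.card_zpowers, orderOf_pow, h.mOf_eq,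
    Nat.div_mul_cancel (Nat.gcd_dvd_left _ _)]

omit [Finite G] in
lemma card_B_eq (h : f.IsGen a b t) : Nat.card f.B = orderOf b := by
  rw [h.B_eq, Nat.card_zpowers]

lemma exponent_eq (h : f.IsGen a b t) {p : ℕ} (hp : p.Prime) (hG : IsPGroup p G)
    (ht : NiceExp p t) (hab : mOf f ≤ Nat.card f.B) : Monoid.exponent G = Nat.card f.B := by
  have hq := IsPQuot.id_of_isPGroup hp hG
  obtain ⟨i, hi⟩ := hq.exists_orderOf a
  obtain ⟨k, hk⟩ := hq.exists_orderOf b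
  rw [h.mOf_eq, h.card_B_eq, hi, hk] at hab
  have hik : i ≤ k := (Nat.pow_le_pow_iff_right hp.one_lt).1 hab
  rw [h.card_B_eq]
  refine Nat.dvd_antisymm ?_ (Monoid.order_dvd_exponent b)
  refine Monoid.exponent_dvd_of_forall_pow_eq_one fun g => ?_
  obtain ⟨l, j, rfl⟩ := h.cover' g
  rw [hk]
  refine mul_pow_prime_pow_eq_one hp ht h.conj ?_ ?_ _ _
  · rw [← orderOf_dvd_iff_pow_eq_one, hi]
    exact pow_dvd_pow _ hik
  · rw [← hk, pow_orderOf_eq_one]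

/-- If the kernel of a second factorization of a `p`-group has index `r'` over the commutator
subgroup, smaller than the index `r` of the kernel of the first one, then `s` is at most `r'` for
the first factorization. -/
lemma sOf_le_of_lt (h : f.IsGen a b t) {p : ℕ} (hp : p.Prime) (hG : IsPGroup p G)
    (hab : mOf f ≤ Nat.card f.B) (f' : MetacyclicFact G) {r r' : ℕ}
    (hr : Nat.card (commutator G) * r = mOf f) (hr' : Nat.card (commutator G) * r' = mOf f')
    (hle : commutator G ≤ f'.A)
    (hlt : r' < r) : sOf f ≤ r' := by
  have hq := IsPQuot.id_of_isPGroup hp hG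
  have hqQ : IsPQuot p (MonoidHom.id (Abelianization G)) :=
    IsPQuot.id_of_isPGroup hp (hG.to_quotient _)
  let π : G →* Abelianization G := Abelianization.of
  have hπ : ∀ x, π x = 1 ↔ x ∈ commutator G := fun x => by
    rw [← Abelianization.ker_of, MonoidHom.mem_ker]
  have hπs : Function.Surjective π := QuotientGroup.mk'_surjective _
  have ha : a ∈ f.A := h.A_eq ▸ Subgroup.mem_zpowers a
  have hb : b ∈ f.B := h.B_eq ▸ Subgroup.mem_zpowers b
  have hleA : commutator G ≤ f.A := by
    rw [h.commutator_eq, h.A_eq, Subgroup.zpowers_le]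
    exact Subgroup.npow_mem_zpowers _ _
  have hcpos : 0 < Nat.card (commutator G) := Nat.card_pos
  have hm0 := h.mOf_ne_zero
  -- `r` and `r'` are powers of `p`
  obtain ⟨μ, hμ⟩ := hq.exists_card_subgroup f.A
  obtain ⟨ρ, -, hρ⟩ := (Nat.dvd_prime_pow hp).1 ((Dvd.intro_left _ hr).trans hμ.dvd)
  have hr0 : r ≠ 0 := by rintro rfl; exact hm0 (by rw [← hr, mul_zero])
  -- `a ^ r` generates the commutator subgroup
  have har : commutator G = Subgroup.zpowers (a ^ r) := by
    have hmem : a ^ r ∈ commutator G := by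
      have h1 : (commutator G).relIndex f.A = r := by
        have h2 := Subgroup.card_mul_index ((commutator G).subgroupOf f.A)
        rw [Nat.card_congr (Subgroup.subgroupOfEquivOfLe hleA).toEquiv] at h2
        exact Nat.eq_of_mul_eq_mul_left hcpos (h2.trans hr.symm)
      have h3 := ((commutator G).subgroupOf f.A).pow_index_mem ⟨a, ha⟩
      change a ^ ((commutator G).relIndex f.A) ∈ commutator G at h3
      rwa [h1] at h3
    refine (Subgroup.eq_of_le_of_card_ge (by rwa [Subgroup.zpowers_le]) ?_).symm
    rw [Nat.card_zpowers]
    have h4 := orderOf_le_mul_orderOf_pow a hr0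
    rw [← h.mOf_eq, ← hr, mul_comm] at h4
    exact Nat.le_of_mul_le_mul_left h4 (Nat.pos_of_ne_zero hr0)
  obtain ⟨x, hx⟩ := hqQ.exists_orderOf (π b)
  have hbx : b ^ p ^ x ∈ commutator G := by rw [← hπ, map_pow, ← hx, pow_orderOf_eq_one]
  have hpx0 : p ^ x ≠ 0 := pow_ne_zero _ hp.ne_zero
  have hrx : r ≤ p ^ x := by
    have h1 := orderOf_le_mul_orderOf_pow b hpx0
    have h2 := orderOf_le_card_of_mem hbx
    rw [h.card_B_eq, ← hr] at hab
    have h3 := hab.trans (h1.trans (Nat.mul_le_mul_left _ h2))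
    rw [mul_comm] at h3
    exact Nat.le_of_mul_le_mul_right h3 hcpos
  have hrx' : r ∣ p ^ x := by
    rw [hρ] at hrx ⊢
    exact pow_dvd_pow _ ((Nat.pow_le_pow_iff_right hp.one_lt).1 hrx)
  have hexp : ∀ g : G, g ^ p ^ x ∈ commutator G := by
    intro g
    rw [← hπ]
    obtain ⟨i, j, rfl⟩ := h.cover g
    have h1 : π a ^ p ^ x = 1 := by
      rw [← map_pow, hπ, har]
      obtain ⟨c, hc⟩ := hrx'
      rw [hc, pow_mul]
      exact Subgroup.npow_mem_zpowers _ _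
    have h2 : π b ^ p ^ x = 1 := by rw [← map_pow, hπ]; exact hbx
    rw [map_pow, map_mul, map_pow, map_pow, mul_pow, pow_right_comm, h1, pow_right_comm, h2]
    simp
  have hn' : nOf f' ≤ p ^ x := by
    obtain ⟨c, d, t', h'⟩ := f'.exists_isGen
    have hd : d ^ p ^ x ∈ f'.A ⊓ f'.B := by
      refine ⟨hle (hexp d), ?_⟩
      rw [h'.B_eq]
      exact Subgroup.npow_mem_zpowers _ _
    have h1 := f'.card_inf_mul_nOf
    have h2 := orderOf_le_mul_orderOf_pow d hpx0
    have h3 := orderOf_le_card_of_mem hd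
    rw [h'.card_B_eq] at h1
    rw [← h1, mul_comm] at h2
    exact Nat.le_of_mul_le_mul_right (h2.trans (Nat.mul_le_mul_left _ h3)) Nat.card_pos
  set e := (Subgroup.zpowers (π b)).index with he
  have hcardQ : Nat.card (Abelianization G) = r' * nOf f' := by
    have h1 : Nat.card G = Nat.card (Abelianization G) * Nat.card (commutator G) :=
      Subgroup.card_eq_card_quotient_mul_card_subgroup _
    refine Nat.eq_of_mul_eq_mul_right hcpos ?_
    rw [← h1, ← f'.mOf_mul_nOf, ← hr']
    ring
  have her' : e ≤ r' := by
    have h1 := Subgroup.card_mul_index (Subgroup.zpowers (π b))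
    rw [Nat.card_zpowers, hx, hcardQ, ← he] at h1
    have h2 := h1.le.trans (Nat.mul_le_mul_left r' hn')
    rw [mul_comm] at h2
    exact Nat.le_of_mul_le_mul_right h2 (Nat.pos_of_ne_zero hpx0)
  obtain ⟨y, hy⟩ : ∃ y, e = p ^ y := by
    obtain ⟨z, hz⟩ := hqQ.exists_card_subgroup ⊤
    rw [Subgroup.card_top] at hz
    obtain ⟨y, -, hy⟩ := (Nat.dvd_prime_pow hp).1
      ((Subgroup.index_dvd_card (Subgroup.zpowers (π b))).trans hz.dvd)
    exact ⟨y, hy⟩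
  have hper : e * p ∣ r := by
    have h1 := her'.trans_lt hlt
    rw [hy, hρ] at h1 ⊢
    rw [← pow_succ]
    exact pow_dvd_pow _ ((Nat.pow_lt_pow_iff_right hp.one_lt).1 h1)
  have hae : a ^ e ∈ f.B := by
    have h1 : π a ^ e ∈ Subgroup.zpowers (π b) := Subgroup.pow_index_mem _ _
    obtain ⟨k, hk⟩ := h1
    have h2 : (b ^ k)⁻¹ * a ^ e ∈ commutator G := by
      rw [← hπ, map_mul, map_inv, map_zpow, map_pow]
      change (π b ^ k)⁻¹ * _ = 1
      rw [← hk]; simp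
    rw [har] at h2
    obtain ⟨z, hz⟩ := h2
    obtain ⟨w, hw⟩ := hper
    have h3 : (a ^ e) ^ (1 - (p : ℤ) * (w * z)) ∈ f.B := by
      have h4 : (a ^ r) ^ z = (a ^ e) ^ ((p : ℤ) * (w * z)) := by
        rw [hw, mul_assoc, pow_mul, ← zpow_natCast, ← zpow_mul]; push_cast; ring_nf
      have h5 : (a ^ e) ^ (1 - (p : ℤ) * (w * z)) = b ^ k := by
        rw [zpow_sub, zpow_one, ← h4]
        change (a ^ r) ^ z = _ at hz
        rw [hz]; group
      rw [h5]
      exact f.B.zpow_mem hb k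
    refine mem_of_zpow_mem ?_ h3
    obtain ⟨i, hi⟩ := hq.exists_orderOf (a ^ e)
    rw [hi, Nat.cast_pow]
    exact IsCoprime.pow_right ⟨1, w * z, by ring⟩
  have h1 := orderOf_le_mul_orderOf_pow a (n := e) (by rw [hy]; exact pow_ne_zero _ hp.ne_zero)
  have h2 := orderOf_le_card_of_mem (H := f.A ⊓ f.B) ⟨f.A.pow_mem ha e, hae⟩
  rw [← h.mOf_eq, ← f.card_inf_mul_sOf, mul_comm] at h1
  exact (Nat.le_of_mul_le_mul_right (h1.trans (Nat.mul_le_mul_left _ h2)) Nat.card_pos).trans her'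

end MetacyclicFact.IsGen

/-! ### The exponent of conjugation on a `p`-quotient -/

namespace MetacyclicFact

/-- The factorization given by a normal cyclic subgroup and a cyclic supplement. -/
def ofZPowers (x y : G) (hx : (Subgroup.zpowers x).Normal)
    (hxy : Subgroup.zpowers x ⊔ Subgroup.zpowers y = ⊤) : MetacyclicFact G where
  A := Subgroup.zpowers x
  B := Subgroup.zpowers y
  normalA := hx
  cyclicA := inferInstance
  cyclicB := inferInstance
  mul_cover g := by
    have hg : g ∈ Subgroup.zpowers x ⊔ Subgroup.zpowers y := hxy ▸ Subgroup.mem_top g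
    obtain ⟨u, hu, v, hv, huv⟩ := Subgroup.mem_sup_of_normal_left.1 hg
    exact ⟨u, hu, v, hv, huv.symm⟩

namespace IsGen

variable {P : Type*} [Group P] [Finite G] {p : ℕ} {φ : G →* P} {f : MetacyclicFact G} {a b : G}
  {t : ℕ}

lemma modEq_one (h : f.IsGen a b t) (hp : p.Prime) (hG : IsPGroup p G) (hm : p ∣ mOf f) :
    t ≡ 1 [MOD p] := by
  have : Fact p.Prime := ⟨hp⟩
  obtain ⟨k, hk⟩ := (IsPQuot.id_of_isPGroup hp hG).exists_orderOf b
  have h1 := conj_pow_exp h.conj (p ^ k)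
  rw [← hk, pow_orderOf_eq_one, inv_one, one_mul, mul_one, hk] at h1
  nth_rw 1 [← pow_one a] at h1
  rw [pow_eq_pow_iff_modEq, ← h.mOf_eq] at h1
  have h2 := (h1.of_dvd hm).symm
  rw [← ZMod.natCast_eq_natCast_iff] at h2 ⊢
  rwa [Nat.cast_pow, ZMod.pow_card_pow] at h2

lemma exists_niceExp (h : f.IsGen a b t) (hφ : IsPQuot p φ) (he : p ≠ 2 ∨ epsOf f = 1) :
    ∃ t', NiceExp p t' ∧ (f.map φ hφ.surj).IsGen (φ a) (φ b) t' ∧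
      (ordProj[p] (mOf f)).gcd (t' - 1) = ordProj[p] (rOf f) := by
  have hP := hφ.finite
  have g := h.map hφ.surj
  have hmφ := f.mOf_map hφ
  rw [h.ordProj_rOf hφ.prime he]
  by_cases hm : ordProj[p] (mOf f) ∣ t - 1
  · refine ⟨1, ⟨rfl, fun _ => rfl⟩, ⟨g.A_eq, g.B_eq, le_rfl, ?_⟩, ?_⟩
    · rw [g.conj, pow_eq_pow_iff_modEq, ← g.mOf_eq, hmφ]
      exact ((Nat.modEq_iff_dvd' g.one_le).2 hm).symm
    · rw [Nat.gcd_eq_left hm]; simp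
  · have hm0 : (mOf f).factorization p ≠ 0 := by
      intro h0
      rw [h0, pow_zero] at hm
      exact hm (one_dvd _)
    have h1 : t ≡ 1 [MOD p] := by
      refine g.modEq_one hφ.prime hφ.isPGroup ?_
      rw [hmφ]
      exact dvd_pow_self p hm0
    refine ⟨t, ⟨h1, ?_⟩, g, rfl⟩
    rintro rfl
    have h2 : 2 ∣ t - 1 := (Nat.modEq_iff_dvd' h.one_le).1 h1.symm
    have hm1 : (mOf f).factorization 2 ≠ 1 := by
      intro h0
      rw [h0, pow_one] at hm
      exact hm h2
    have h4 : 2 ^ 2 ∣ mOf f := (pow_dvd_pow 2 (by omega)).trans (Nat.ordProj_dvd _ 2)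
    have h5 : 2 ^ 2 ∣ rOf f := by
      refine h.two_pow_dvd_rOf h4 ?_
      have := h.one_le
      omega
    have h6 := ((h.pow_dvd_rOf_iff Nat.prime_two he 2).1 h5).2
    exact ((Nat.modEq_iff_dvd' h.one_le).2 h6).symm

lemma card_commutator_of_epsOf_ne_one (h : f.IsGen a b t) (hφ : IsPQuot 2 φ)
    (he : epsOf f ≠ 1) :
    Nat.card (commutator P) * 2 = ordProj[2] (mOf f) ∧ 4 ∣ ordProj[2] (mOf f) := by
  have hP := hφ.finite
  rw [Ne, h.ordProj_dvd_of_epsOf] at he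
  have h1 := h.rOf_spec.2.2.resolve_left he
  have ht := h.one_le
  have h2 : 2 ≤ (rOf f).factorization 2 := by
    by_contra! hlt
    interval_cases (rOf f).factorization 2 <;> omega
  have h3 : 2 ^ 2 ∣ t + 1 := (pow_dvd_pow 2 h2).trans h1
  have h4 : 2 ^ 2 ∣ ordProj[2] (mOf f) := pow_dvd_ordProj_of_dvd Nat.prime_two h.mOf_ne_zero
    ((pow_dvd_pow 2 h2).trans ((Nat.ordProj_dvd _ 2).trans h.rOf_spec.1))
  refine ⟨?_, h4⟩
  have h5 := (h.map hφ.surj).card_commutator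
  rw [f.mOf_map hφ] at h5
  suffices h6 : (ordProj[2] (mOf f)).gcd (t - 1) = 2 by rwa [h6] at h5
  obtain ⟨i, -, hi⟩ := (Nat.dvd_prime_pow Nat.prime_two).1
    (Nat.gcd_dvd_left (ordProj[2] (mOf f)) (t - 1))
  have h7 : 2 ∣ (ordProj[2] (mOf f)).gcd (t - 1) :=
    Nat.dvd_gcd (dvd_trans (by norm_num) h4) (by omega)
  have h8 : ¬ 2 ^ 2 ∣ (ordProj[2] (mOf f)).gcd (t - 1) := by
    intro h9
    have := h9.trans (Nat.gcd_dvd_right _ _)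
    omega
  rw [hi] at h7 h8 ⊢
  have h9 : i < 2 := by
    by_contra! h9
    exact h8 (pow_dvd_pow 2 h9)
  interval_cases i
  · omega
  · rfl

/-- In a minimal factorization the `p`-part of `|A|` is at most that of `|B|`. -/
lemma mOf_map_le_card_B (h : f.IsGen a b t) (hf : IsMinimalFact f) (hφ : IsPQuot p φ) {t' : ℕ}
    (ht' : NiceExp p t') (h' : (f.map φ hφ.surj).IsGen (φ a) (φ b) t') :
    mOf (f.map φ hφ.surj) ≤ Nat.card (f.map φ hφ.surj).B := by
  have hP := hφ.finite
  have hp := hφ.prime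
  rw [h'.mOf_eq, h'.card_B_eq]
  by_contra! hlt
  obtain ⟨l, hl⟩ := hφ.exists_orderOf (φ a)
  obtain ⟨k, hk⟩ := hφ.exists_orderOf (φ b)
  rw [hl, hk] at hlt
  obtain ⟨i, rfl⟩ : ∃ i, l = i + 1 :=
    Nat.exists_eq_add_one_of_ne_zero fun h0 => by
      rw [h0, pow_zero] at hlt
      exact hlt.not_ge (Nat.one_le_pow _ _ hp.pos)
  have hki : k ≤ i := Nat.lt_succ_iff.1 ((Nat.pow_lt_pow_iff_right hp.one_lt).1 hlt)
  obtain ⟨n, hn, hno⟩ := hφ.exists_lift a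
  set α := a ^ n with hα
  have hαb : b⁻¹ * α * b = α ^ t' := by
    rw [hα, conj_pow_base h.conj]
    refine IsPQuot.pow_eq_pow (φ := φ) (by rw [hno, hn]) ?_
    rw [hn, ← (h.map hφ.surj).conj, h'.conj]
  have hb'1 : p ^ (i + 1) ∣ orderOf (b * α) := by
    obtain ⟨j, hj⟩ := hφ.exists_orderOf (φ (b * α))
    refine dvd_trans ?_ (hj ▸ orderOf_map_dvd φ (b * α))
    refine pow_dvd_pow _ ?_
    by_contra! hji
    have h1 : φ (b * α) ^ p ^ i = 1 := by
      rw [← orderOf_dvd_iff_pow_eq_one, hj]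
      exact pow_dvd_pow _ (by omega)
    obtain ⟨u, hu, hpu⟩ := ht'.geom_sum_pow hp i
    have h2 : φ b ^ p ^ i = 1 := by
      rw [← orderOf_dvd_iff_pow_eq_one, hk]
      exact pow_dvd_pow _ hki
    rw [map_mul, hn, mul_pow_of_conj h'.conj, h2, one_mul, hu, ← orderOf_dvd_iff_pow_eq_one, hl,
      pow_succ] at h1
    exact hpu (Nat.dvd_of_mul_dvd_mul_left (pow_pos hp.pos _) h1)
  have hb'2 : ordCompl[p] (orderOf b) ∣ orderOf (b * α) := by
    have h1 : (b * α) ^ p ^ (i + 1) = b ^ p ^ (i + 1) := by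
      obtain ⟨u, hu, -⟩ := ht'.geom_sum_pow hp (i + 1)
      rw [mul_pow_of_conj hαb, hu, pow_mul, ← hl, ← hno, pow_orderOf_eq_one, one_pow, mul_one]
    refine ordCompl_dvd_of_dvd_mul (i := i + 1) hp (orderOf_pos b).ne' ?_
    refine orderOf_dvd_of_pow_eq_one ?_
    rw [pow_mul, ← h1, ← pow_mul, mul_comm, pow_mul, pow_orderOf_eq_one, one_pow]
  have hb' : orderOf b < orderOf (b * α) := by
    have hb0 := (orderOf_pos b).ne'
    have h1 : p ^ (i + 1) * ordCompl[p] (orderOf b) ∣ orderOf (b * α) :=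
      ((Nat.coprime_ordCompl hp hb0).pow_left _).mul_dvd_of_dvd_of_dvd hb'1 hb'2
    refine lt_of_lt_of_le ?_ (Nat.le_of_dvd (orderOf_pos _) h1)
    conv_lhs => rw [← Nat.ordProj_mul_ordCompl_eq_self (orderOf b) p]
    have hpos := Nat.ordCompl_pos p hb0
    rw [← hφ.orderOf_eq, hk] at hpos ⊢
    exact Nat.mul_lt_mul_of_pos_right hlt hpos
  have hαA : α ∈ Subgroup.zpowers a := Subgroup.npow_mem_zpowers _ _
  have hsup : Subgroup.zpowers a ⊔ Subgroup.zpowers (b * α) = ⊤ := by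
    rw [eq_top_iff, ← f.A_sup_B, h.A_eq, h.B_eq]
    refine sup_le le_sup_left ?_
    have hb : b * α * α⁻¹ ∈ Subgroup.zpowers a ⊔ Subgroup.zpowers (b * α) := mul_mem
      (Subgroup.mem_sup_right (Subgroup.mem_zpowers _))
      (Subgroup.mem_sup_left (inv_mem hαA))
    rwa [mul_inv_cancel_right, ← Subgroup.zpowers_le] at hb
  have hmin := hf (ofZPowers a (b * α) (h.A_eq ▸ f.normalA) hsup)
  simp only [lex3, factTriple, ofZPowers, h.A_eq, lt_irrefl, false_or, true_and] at hmin
  have h1 := f.card_B_mul_sOf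
  rw [h.card_B_eq, ← Subgroup.card_mul_index (Subgroup.zpowers (b * α)), Nat.card_zpowers] at h1
  have h2 : 0 < (Subgroup.zpowers (b * α)).index :=
    Nat.pos_of_ne_zero Subgroup.index_ne_zero_of_finite
  exact (Nat.mul_lt_mul_of_lt_of_le hb' hmin
    (Nat.pos_of_ne_zero Subgroup.index_ne_zero_of_finite)).ne h1

end IsGen

end MetacyclicFact

/-- A Sylow `p`-subgroup is the quotient by a normal Hall `p'`-subgroup. -/
lemma exists_isPQuot_sylow [Finite G] {p : ℕ} (hp : p.Prime) (hppi : p ∈ piSet G)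
    (P : Sylow p G) : ∃ φ : G →* (P : Subgroup G), IsPQuot p φ := by
  have : Fact p.Prime := ⟨hp⟩
  obtain ⟨-, -, N, hN, hcard⟩ := hppi
  have hG : Nat.card G ≠ 0 := Nat.card_pos.ne'
  have hPc : Nat.card (P : Subgroup G) = ordProj[p] (Nat.card G) := P.card_eq_multiplicity
  have hcop : p.Coprime (Nat.card N) := hcard ▸ Nat.coprime_ordCompl hp hG
  have hcompl : Subgroup.IsComplement' (P : Subgroup G) N := by
    refine Subgroup.isComplement'_of_coprime ?_ ?_
    · rw [hPc, hcard, Nat.ordProj_mul_ordCompl_eq_self]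
    · rw [hPc]
      exact hcop.pow_left _
  let e := hcompl.QuotientMulEquiv
  refine ⟨e.toMonoidHom.comp (QuotientGroup.mk' N), hp,
    e.surjective.comp (QuotientGroup.mk'_surjective N), P.isPGroup', ?_⟩
  have hker : (e.toMonoidHom.comp (QuotientGroup.mk' N)).ker = N := by
    ext x
    simp
  rwa [hker]

/-! ### Shrinking the kernel of a factorization -/

lemma pow_dvd_natPart {n q i : ℕ} {σ : Set ℕ} (hq : q.Prime) (hn : n ≠ 0) (hqσ : q ∈ σ)
    (h : q ^ i ∣ n) : q ^ i ∣ natPart n σ := by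
  rcases eq_or_ne i 0 with rfl | hi
  · simp
  have hmem : q ∈ n.primeFactors := Nat.mem_primeFactors.2 ⟨hq, (dvd_pow_self q hi).trans h, hn⟩
  have h1 := Finset.dvd_prod_of_mem (fun q => if q ∈ σ then q ^ n.factorization q else 1) hmem
  simp only [if_pos hqσ] at h1
  exact (pow_dvd_ordProj_of_dvd hq hn h).trans h1

lemma pow_succ_dvd_pow_sub_one {t q : ℕ} (ht : 1 ≤ t) (h : q ∣ t - 1) (i : ℕ) :
    q ^ (i + 1) ∣ t ^ q ^ i - 1 := by
  have h1 : (q : ℤ) ∣ (t : ℤ) - 1 := by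
    rw [← Int.natCast_dvd_natCast] at h
    simpa [Nat.cast_sub ht] using h
  have h2 := dvd_sub_pow_of_dvd_sub h1 i
  rw [← Int.natCast_dvd_natCast, Nat.cast_sub (Nat.one_le_pow _ _ ht)]
  simpa using h2

namespace MetacyclicFact.IsGen

variable [Finite G] {f : MetacyclicFact G} {a b : G} {t : ℕ}

lemma dvd_pow_kOf_mul (h : f.IsGen a b t) {d : ℕ} (hd : d ∣ mOf f) :
    d ∣ t ^ (kOf f * d) - 1 := by
  refine (Nat.dvd_iff_prime_pow_dvd_dvd _ _).2 fun q i hq hqi => ?_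
  rcases eq_or_ne i 0 with rfl | hi
  · simp
  by_cases hqr : q ∣ rOf f
  · have hqt : q ∣ t - 1 := by
      obtain ⟨-, h1, h2⟩ := h.rOf_spec
      rcases eq_or_ne q 2 with rfl | hq2
      · have h3 : 2 ∣ ordProj[2] (rOf f) := by
          simpa using pow_dvd_ordProj_of_dvd (i := 1) hq h.rOf_ne_zero (by simpa using hqr)
        have := h.one_le
        rcases h2 with h2 | h2
        · exact h3.trans h2
        · have := h3.trans h2
          omega
      · refine dvd_trans ?_ h1
        have h3 : q ∣ ordProj[2] (rOf f) * ordCompl[2] (rOf f) := by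
          rwa [Nat.ordProj_mul_ordCompl_eq_self]
        exact (((Nat.coprime_primes hq Nat.prime_two).2 hq2).pow_right _).dvd_of_dvd_mul_left h3
    have h3 := pow_succ_dvd_pow_sub_one h.one_le hqt i
    refine ((pow_dvd_pow q i.le_succ).trans h3).trans (Nat.pow_sub_one_dvd_pow_sub_one t ?_)
    exact hqi.mul_left _
  · have h1 := (h.kOf_dvd_iff (kOf f)).1 dvd_rfl
    have h2 : q ^ i ∣ natPart (mOf f) {p | ¬ p ∣ rOf f} :=
      pow_dvd_natPart hq h.mOf_ne_zero hqr (hqi.trans hd)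
    exact (h2.trans h1).trans (Nat.pow_sub_one_dvd_pow_sub_one t (dvd_mul_right _ _))

end MetacyclicFact.IsGen

lemma modEq_geom_sum {T m : ℤ} (h : T ≡ 1 [ZMOD m]) (n : ℕ) :
    ∑ i ∈ Finset.range n, T ^ i ≡ n [ZMOD m] := by
  simpa using Int.ModEq.sum (s := Finset.range n) fun i _ => h.pow i

lemma exists_pow_mul_mem {x y : G} {p t L μ ρ σ : ℕ} (hp : p.Prime) (h : y⁻¹ * x * y = x ^ t)
    (hx : orderOf x = p ^ μ) (ht1 : 1 ≤ t) (ht : p ^ ρ ∣ t - 1) (hσ : σ < ρ)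
    (hL : y ^ (L * p ^ σ) * x ^ p ^ σ = 1) :
    ∃ j, L ∣ j ∧ (y ^ j * x) ^ p ^ σ ∈ Subgroup.zpowers (x ^ p ^ ρ) ∧
      x ^ p ^ ρ ∈ Subgroup.zpowers (y ^ j * x) := by
  let S : ℕ → ℤ := fun j => ∑ i ∈ Finset.range (p ^ σ), ((t : ℤ) ^ j) ^ i
  have hTr : (t : ℤ) ≡ 1 [ZMOD (p ^ ρ : ℕ)] := by
    have := ((Nat.modEq_iff_dvd' ht1).2 ht).symm
    exact_mod_cast (Int.natCast_modEq_iff).2 this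
  have hTp : (t : ℤ) ^ p ≡ 1 [ZMOD (p ^ (ρ + 1) : ℕ)] := by
    have h1 := hTr.symm.dvd
    have h2 : (p : ℤ) ∣ ∑ i ∈ Finset.range p, (t : ℤ) ^ i := by
      have h3 : (t : ℤ) ≡ 1 [ZMOD p] := hTr.of_dvd (by
        exact_mod_cast dvd_pow_self p (Nat.ne_zero_of_lt hσ))
      have h4 := modEq_geom_sum h3 p
      exact (Int.modEq_zero_iff_dvd).1 (h4.trans (Int.modEq_zero_iff_dvd.2 dvd_rfl))
    refine (Int.modEq_iff_dvd.2 ?_).symm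
    rw [← geom_sum_mul, mul_comm]
    push_cast at h1 ⊢
    rw [pow_succ]
    exact mul_dvd_mul h1 h2
  have hpow : ∀ w, (y ^ (L * (1 + w)) * x) ^ p ^ σ =
      x ^ (S (L * (1 + w)) - p ^ σ * (1 + w)) := by
    intro w
    have h1 := mul_pow_of_conj (conj_pow_exp h (L * (1 + w))) (p ^ σ)
    have h2 : y ^ (L * p ^ σ) = x ^ (-(p ^ σ : ℤ)) := by
      rw [eq_inv_of_mul_eq_one_left hL, zpow_neg]
      norm_cast
    have h3 : (y ^ (L * (1 + w))) ^ p ^ σ = x ^ (-(p ^ σ : ℤ) * (1 + w)) := by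
      rw [← pow_mul, mul_right_comm, pow_mul, h2, ← zpow_natCast, ← zpow_mul]
      push_cast
      rfl
    rw [h1, h3, ← zpow_natCast, ← zpow_add]
    congr 1
    simp only [S]
    push_cast
    ring
  have hS : ∀ j, S j ≡ p ^ σ [ZMOD (p ^ ρ : ℕ)] := fun j => by
    exact_mod_cast modEq_geom_sum (by simpa using hTr.pow j) (p ^ σ)
  obtain ⟨κ, hκ⟩ : ∃ κ, ρ = σ + (κ + 1) := Nat.exists_eq_add_of_lt hσ
  have hdvd : ∀ c : ℕ, ((p ^ ρ : ℕ) : ℤ) ∣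
      S (L * (1 + p ^ (κ + 1) * c)) - p ^ σ * (1 + ((p ^ (κ + 1) * c : ℕ) : ℤ)) := by
    intro c
    have h1 : (p : ℤ) ^ σ * (1 + ((p ^ (κ + 1) * c : ℕ) : ℤ)) = p ^ σ + (p ^ ρ : ℕ) * c := by
      rw [hκ]; push_cast; ring
    rw [h1, ← sub_sub]
    exact dvd_sub (hS _).symm.dvd (dvd_mul_right _ _)
  obtain ⟨c, e, he, hpe⟩ : ∃ c : ℕ, ∃ e : ℤ,
      S (L * (1 + p ^ (κ + 1) * c)) - p ^ σ * (1 + ((p ^ (κ + 1) * c : ℕ) : ℤ)) =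
        (p ^ ρ : ℕ) * e ∧ ¬ (p : ℤ) ∣ e := by
    by_contra! hall
    obtain ⟨e₀, he₀⟩ := hdvd 0
    obtain ⟨e₁, he₁⟩ := hdvd 1
    have h0 := hall 0 e₀ he₀
    have h1 := hall 1 e₁ he₁
    have hSS : S (L * (1 + p ^ (κ + 1) * 1)) ≡ S (L * (1 + p ^ (κ + 1) * 0))
        [ZMOD (p ^ (ρ + 1) : ℕ)] := by
      refine Int.ModEq.sum fun i _ => Int.ModEq.pow i ?_
      have h2 : (t : ℤ) ^ (L * (1 + p ^ (κ + 1) * 1)) =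
          t ^ (L * (1 + p ^ (κ + 1) * 0)) * (t ^ p) ^ (L * p ^ κ) := by
        rw [← pow_mul, ← pow_add]; congr 1; ring
      rw [h2]
      simpa using (Int.ModEq.refl (t ^ (L * (1 + p ^ (κ + 1) * 0)) : ℤ)).mul (hTp.pow (L * p ^ κ))
    have hp0 : ((p ^ ρ : ℕ) : ℤ) ≠ 0 := by exact_mod_cast (pow_pos hp.pos ρ).ne'
    have h3 : S (L * (1 + p ^ (κ + 1) * 0)) - S (L * (1 + p ^ (κ + 1) * 1)) =
        (p ^ ρ : ℕ) * (e₀ - e₁ - 1) := by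
      have h4 : (p : ℤ) ^ σ * (p ^ (κ + 1)) = (p ^ ρ : ℕ) := by rw [hκ]; push_cast; ring
      push_cast at he₀ he₁ h4 ⊢
      linear_combination he₀ - he₁ - h4
    have h5 := hSS.dvd
    rw [h3, pow_succ, Nat.cast_mul] at h5
    have h6 := Int.dvd_of_mul_dvd_mul_left hp0 h5
    have h7 : (p : ℤ) ∣ 1 := by
      have := dvd_sub (dvd_sub h0 h1) h6
      simpa using this
    exact hp.one_lt.ne' (by exact_mod_cast Int.eq_one_of_dvd_one (by positivity) h7)
  refine ⟨L * (1 + p ^ (κ + 1) * c), dvd_mul_right _ _, ?_, ?_⟩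
  · rw [hpow, he, zpow_mul, zpow_natCast]
    exact Subgroup.zpow_mem_zpowers _ _
  · refine mem_of_zpow_mem (c := e) ?_ ?_
    · have h1 : orderOf (x ^ p ^ ρ) ∣ p ^ μ := hx ▸ orderOf_pow_dvd _
      obtain ⟨i, -, hi⟩ := (Nat.dvd_prime_pow hp).1 h1
      rw [hi, Nat.cast_pow]
      exact (((Nat.prime_iff_prime_int.1 hp).coprime_iff_not_dvd).2 hpe).symm.pow_right
    · rw [← zpow_natCast x (p ^ ρ), ← zpow_mul, ← he, ← hpow]
      exact Subgroup.npow_mem_zpowers _ _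

lemma normal_zpowers_of_gen {x a b : G} (hgen : ∀ g, ∃ i j : ℕ, g = a ^ i * b ^ j)
    (ha : a⁻¹ * x * a ∈ Subgroup.zpowers x) (hb : b⁻¹ * x * b ∈ Subgroup.zpowers x) :
    (Subgroup.zpowers x).Normal := by
  have key : ∀ c : G, c⁻¹ * x * c ∈ Subgroup.zpowers x → ∀ (n : ℕ), ∀ y ∈ Subgroup.zpowers x,
      (c ^ n)⁻¹ * y * c ^ n ∈ Subgroup.zpowers x := by
    intro c hc n
    induction n with
    | zero => simp
    | succ n ih =>
      intro y hy
      obtain ⟨k, hk⟩ := ih y hy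
      have h1 : (c ^ (n + 1))⁻¹ * y * c ^ (n + 1) = (c⁻¹ * x * c) ^ k := by
        have h2 := conj_zpow (i := k) (a := c⁻¹) (b := x)
        rw [inv_inv] at h2
        change x ^ k = _ at hk
        rw [h2, hk, pow_succ]
        group
      rw [h1]
      exact Subgroup.zpow_mem _ hc k
  refine normal_zpowers_of_forall_conj_mem fun g => ?_
  obtain ⟨i, j, rfl⟩ := hgen g
  have h1 := key b hb j _ (key a ha i x (Subgroup.mem_zpowers x))
  simpa [mul_assoc] using h1

namespace MetacyclicFact.IsGen

variable {P : Type*} [Group P] [Finite G] {p : ℕ} {φ : G →* P} {f : MetacyclicFact G} {a b : G}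
  {t : ℕ}

lemma exists_pow_mul_pow_sOf_eq_one (h : f.IsGen a b t) :
    ∃ z : ℕ, b ^ (nOf f * z) * a ^ sOf f = 1 := by
  have hn := f.normalA
  have ha : a ∈ f.A := h.A_eq ▸ Subgroup.mem_zpowers a
  have hb : b ∈ f.B := h.B_eq ▸ Subgroup.mem_zpowers b
  have hbn : b ^ nOf f ∈ f.A ⊓ f.B := ⟨Subgroup.pow_index_mem _ _, f.B.pow_mem hb _⟩
  have heq : Subgroup.zpowers (b ^ nOf f) = f.A ⊓ f.B := by
    refine Subgroup.eq_of_le_of_card_ge (by rwa [Subgroup.zpowers_le]) ?_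
    have h0 : nOf f ≠ 0 := Subgroup.index_ne_zero_of_finite
    have h1 := orderOf_le_mul_orderOf_pow b h0
    rw [← h.card_B_eq, ← f.card_inf_mul_nOf, mul_comm] at h1
    rw [Nat.card_zpowers]
    exact Nat.le_of_mul_le_mul_left h1 (Nat.pos_of_ne_zero h0)
  have has : a ^ sOf f ∈ f.B := by
    have hcyc := f.cyclicA
    let _ : CommGroup f.A := IsCyclic.commGroup
    have hrel : f.B.relIndex f.A = sOf f := by
      have h1 := Subgroup.card_mul_index (f.B.subgroupOf f.A)
      rw [← Subgroup.card_map_of_injective f.A.subtype_injective, Subgroup.subgroupOf_map_subtype,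
        inf_comm] at h1
      have h2 := f.card_inf_mul_sOf
      exact Nat.eq_of_mul_eq_mul_left Nat.card_pos (h1.trans h2.symm)
    have h3 := (f.B.subgroupOf f.A).pow_index_mem ⟨a, ha⟩
    change a ^ (f.B.relIndex f.A) ∈ f.B at h3
    rwa [hrel] at h3
  have h1 : (a ^ sOf f)⁻¹ ∈ Subgroup.zpowers (b ^ nOf f) := by
    rw [heq]
    exact inv_mem ⟨f.A.pow_mem ha _, has⟩
  obtain ⟨z, hz⟩ := exists_nat_pow_of_mem_zpowers h1
  exact ⟨z, by rw [pow_mul, ← hz, inv_mul_cancel]⟩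

/-- A power of `b` with exponent divisible by the `p`-part of `k` centralizes the `p'`-part
of `A`. -/
lemma commute_pow (h : f.IsGen a b t) {y x : G} (hp : p.Prime) (hy : y ∈ Subgroup.zpowers b)
    (hx : x ∈ Subgroup.zpowers a) (hxp : p.Coprime (orderOf x)) {k : ℕ}
    (hyp : orderOf y = p ^ k) : Commute (y ^ ordProj[p] (kOf f)) x := by
  obtain ⟨n, rfl⟩ := exists_nat_pow_of_mem_zpowers hy
  obtain ⟨l, rfl⟩ := exists_nat_pow_of_mem_zpowers hx
  set x := a ^ l with hxdef
  set d := orderOf x with hd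
  have hdm : d ∣ mOf f := by
    rw [h.mOf_eq]
    exact orderOf_pow_dvd _
  have h1 : Commute ((b ^ n) ^ (kOf f * d)) x := by
    have h2 := conj_pow_exp (conj_pow_base h.conj l) (kOf f * d * n)
    have h3 : x ^ t ^ (kOf f * d * n) = x ^ 1 := by
      rw [pow_eq_pow_iff_modEq, ← hd]
      refine ((Nat.modEq_iff_dvd' (Nat.one_le_pow _ _ h.one_le)).2 ?_).symm
      exact (h.dvd_pow_kOf_mul hdm).trans (Nat.pow_sub_one_dvd_pow_sub_one t (dvd_mul_right _ _))
    rw [← hxdef, h3, pow_one, mul_assoc, inv_mul_eq_iff_eq_mul] at h2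
    rw [← pow_mul, mul_comm n]
    exact h2.symm
  have hk0 : kOf f ≠ 0 := by
    intro h0
    have h2 := (h.kOf_dvd_iff (Nat.totient (mOf f))).2 ?_
    · rw [h0, zero_dvd_iff, Nat.totient_eq_zero] at h2
      exact h.mOf_ne_zero h2
    · refine (natPart_dvd h.mOf_ne_zero _).trans ?_
      exact (Nat.modEq_iff_dvd' (Nat.one_le_pow _ _ h.one_le)).1
        (Nat.ModEq.pow_totient h.coprime).symm
  have h4 : (b ^ n) ^ ordProj[p] (kOf f) ∈ Subgroup.centralizer {x} := by
    refine mem_of_zpow_mem (c := ((ordCompl[p] (kOf f) * d : ℕ) : ℤ)) ?_ ?_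
    · rw [Int.isCoprime_iff_gcd_eq_one, Int.gcd_natCast_natCast]
      have h5 : orderOf ((b ^ n) ^ ordProj[p] (kOf f)) ∣ p ^ k := hyp ▸ orderOf_pow_dvd _
      obtain ⟨i, -, hi⟩ := (Nat.dvd_prime_pow hp).1 h5
      rw [hi]
      exact (((Nat.coprime_ordCompl hp hk0).mul_right hxp).pow_left i).symm
    · rw [zpow_natCast, ← pow_mul, ← mul_assoc, Nat.ordProj_mul_ordCompl_eq_self,
        Subgroup.mem_centralizer_singleton_iff]
      exact h1.eq
  exact Subgroup.mem_centralizer_singleton_iff.1 h4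

/-- In a minimal factorization with `s_p < r_p` one has `n_p < k_p s_p`. -/
lemma nOf_lt_of_sOf_lt (h : f.IsGen a b t) (hf : IsMinimalFact f) (hφ : IsPQuot p φ) {t' : ℕ}
    (h' : (f.map φ hφ.surj).IsGen (φ a) (φ b) t') (ht' : NiceExp p t')
    (hs : ordProj[p] (sOf f) < (ordProj[p] (mOf f)).gcd (t' - 1)) :
    ordProj[p] (nOf f) < ordProj[p] (kOf f) * ordProj[p] (sOf f) := by
  have hP := hφ.finite
  have hp := hφ.prime
  by_contra! hlt
  have hmμ : orderOf (φ a) = ordProj[p] (mOf f) := by rw [← h'.mOf_eq, f.mOf_map hφ]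
  obtain ⟨ρ, hρμ, hρ⟩ := (Nat.dvd_prime_pow hp).1 (Nat.gcd_dvd_left (ordProj[p] (mOf f)) (t' - 1))
  have hρt : p ^ ρ ∣ t' - 1 := hρ ▸ Nat.gcd_dvd_right _ _
  rw [hρ, Nat.pow_lt_pow_iff_right hp.one_lt] at hs
  obtain ⟨q, hq⟩ : ordProj[p] (kOf f) * ordProj[p] (sOf f) ∣ ordProj[p] (nOf f) := by
    rw [← pow_add] at hlt ⊢
    exact pow_dvd_pow _ ((Nat.pow_le_pow_iff_right hp.one_lt).1 hlt)
  -- `α` and `β` are the `p`-parts of `a` and `b`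
  obtain ⟨n₁, hα, hαo⟩ := hφ.exists_lift a
  obtain ⟨n₂, hβ, hβo⟩ := hφ.exists_lift b
  have hαa : a ^ n₁ ∈ Subgroup.zpowers a := Subgroup.npow_mem_zpowers _ _
  have hβb : b ^ n₂ ∈ Subgroup.zpowers b := Subgroup.npow_mem_zpowers _ _
  have hαb : b⁻¹ * a ^ n₁ * b = (a ^ n₁) ^ t' := by
    rw [conj_pow_base h.conj]
    refine IsPQuot.pow_eq_pow (φ := φ) (by rw [hαo, hα]) ?_
    rw [hα, ← (h.map hφ.surj).conj, h'.conj]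
  have hαβ : (b ^ n₂)⁻¹ * a ^ n₁ * b ^ n₂ = (a ^ n₁) ^ t' := by
    rw [conj_pow_exp hαb]
    refine IsPQuot.pow_eq_pow (φ := φ) (by rw [hαo, hα]) ?_
    rw [← map_pow, ← conj_pow_exp hαb, map_mul, map_mul, map_inv, hα, hβ, h'.conj]
  set α := a ^ n₁ with hαdef
  set β := b ^ n₂ with hβdef
  set σ := (sOf f).factorization p with hσ
  set μ := (mOf f).factorization p with hμ
  have hαo' : orderOf α = p ^ μ := by rw [hαo, hmμ]
  obtain ⟨w, hw⟩ := hφ.exists_orderOf (φ b)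
  rw [← hβo] at hw
  obtain ⟨z, hz⟩ := h'.exists_pow_mul_pow_sOf_eq_one
  rw [f.nOf_map hφ, f.sOf_map hφ, ← hσ, hq] at hz
  have hL : β ^ (ordProj[p] (kOf f) * q * z * p ^ σ) * α ^ p ^ σ = 1 := by
    have h1 : φ (β ^ (ordProj[p] (kOf f) * q * z * p ^ σ) * α ^ p ^ σ) = 1 := by
      rw [map_mul, map_pow φ β, map_pow φ α, hα, hβ, ← hz]
      congr 2
      ring
    refine hφ.eq_one_of_pow h1 (i := μ + w) ?_
    refine mul_pow_prime_pow_eq_one hp ht' hαβ ?_ ?_ _ _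
    · rw [← orderOf_dvd_iff_pow_eq_one, hαo']
      exact pow_dvd_pow _ (Nat.le_add_right _ _)
    · rw [← orderOf_dvd_iff_pow_eq_one, hw]
      exact pow_dvd_pow _ (Nat.le_add_left _ _)
  obtain ⟨j, ⟨j', hj'⟩, hδ1, hδ2⟩ := exists_pow_mul_mem hp hαβ hαo' h'.one_le hρt hs hL
  set δ := β ^ j * α with hδdef
  -- the `p'`-part of `a`
  obtain ⟨l, hl⟩ := exists_nat_pow_of_mem_zpowers
    (mul_mem (Subgroup.mem_zpowers a) (inv_mem hαa))
  set γ := a * α⁻¹ with hγdef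
  have hγa : γ ∈ Subgroup.zpowers a := hl ▸ Subgroup.npow_mem_zpowers _ _
  have hγp : p.Coprime (orderOf γ) := by
    refine hφ.coprime.coprime_dvd_right ?_
    have h1 : γ ∈ φ.ker := by rw [MonoidHom.mem_ker, map_mul, map_inv, hα, mul_inv_cancel]
    rw [← Nat.card_zpowers]
    exact Subgroup.card_dvd_of_le (by rwa [Subgroup.zpowers_le])
  have hγm : orderOf γ ∣ ordCompl[p] (mOf f) := by
    have h1 : orderOf γ ∣ ordProj[p] (mOf f) * ordCompl[p] (mOf f) := by
      rw [Nat.ordProj_mul_ordCompl_eq_self, h.mOf_eq, hl]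
      exact orderOf_pow_dvd _
    exact (hγp.symm.pow_right _).dvd_of_dvd_mul_left h1
  have hγα : Commute γ α := by
    rw [hl, hαdef]
    exact (Commute.refl a).pow_pow _ _
  have hγβ : Commute (β ^ j) γ := by
    have h1 := (h.commute_pow hp hβb hγa hγp hw).pow_left (q * z * j')
    rwa [← pow_mul, ← mul_assoc, ← mul_assoc, ← hj'] at h1
  have hγδ : Commute γ δ := hγβ.symm.mul_right hγα
  have hδo : orderOf δ ∣ p ^ (σ + μ) := by
    refine orderOf_dvd_of_pow_eq_one ?_
    obtain ⟨c, hc⟩ := exists_nat_pow_of_mem_zpowers hδ1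
    rw [pow_add, pow_mul, hc, ← hαo', pow_right_comm, pow_right_comm α, pow_orderOf_eq_one,
      one_pow, one_pow]
  have hcop : (orderOf γ).Coprime (orderOf δ) :=
    (hγp.symm.pow_right (σ + μ)).coprime_dvd_right hδo
  have hδlt : orderOf δ < p ^ μ := by
    have h1 := orderOf_le_mul_orderOf_pow δ (pow_ne_zero σ hp.ne_zero)
    have h2 := orderOf_le_card_of_mem hδ1
    have h3 : orderOf (α ^ p ^ ρ) * p ^ ρ = p ^ μ := by
      rw [orderOf_pow_of_dvd (pow_ne_zero _ hp.ne_zero) (by rw [hαo']; exact pow_dvd_pow _ hρμ),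
        hαo', Nat.div_mul_cancel (pow_dvd_pow _ hρμ)]
    rw [Nat.card_zpowers] at h2
    calc orderOf δ ≤ p ^ σ * orderOf (α ^ p ^ ρ) := h1.trans (Nat.mul_le_mul_left _ h2)
      _ < p ^ ρ * orderOf (α ^ p ^ ρ) :=
        Nat.mul_lt_mul_of_pos_right (Nat.pow_lt_pow_right hp.one_lt hs) (orderOf_pos _)
      _ = p ^ μ := by rw [mul_comm, h3]
  -- the new kernel
  set x := γ * δ with hx
  have hγx : γ ∈ Subgroup.zpowers x := by
    refine mem_of_zpow_mem (c := (orderOf δ : ℕ)) (Nat.isCoprime_iff_coprime.2 hcop.symm) ?_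
    have h1 : x ^ orderOf δ = γ ^ orderOf δ := by
      rw [hx, hγδ.mul_pow, pow_orderOf_eq_one, mul_one]
    rw [zpow_natCast, ← h1]
    exact Subgroup.npow_mem_zpowers _ _
  have hδx : δ ∈ Subgroup.zpowers x := by
    have h1 : δ = γ⁻¹ * x := by rw [hx, inv_mul_cancel_left]
    rw [h1]
    exact mul_mem (inv_mem hγx) (Subgroup.mem_zpowers x)
  have hαx : ∀ c : ℤ, ((p ^ ρ : ℕ) : ℤ) ∣ c → α ^ c ∈ Subgroup.zpowers x := by
    rintro _ ⟨c, rfl⟩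
    rw [zpow_mul, zpow_natCast]
    refine Subgroup.zpow_mem _ ?_ c
    exact (Subgroup.zpowers_le.2 hδx) hδ2
  have hρt' : ((p ^ ρ : ℕ) : ℤ) ∣ (t' : ℤ) - 1 := by
    rw [← Int.natCast_dvd_natCast, Nat.cast_sub h'.one_le] at hρt
    simpa using hρt
  have hxa : a⁻¹ * x * a ∈ Subgroup.zpowers x := by
    have h1 : a⁻¹ * x * a = γ * (δ * α ^ (1 - (t' : ℤ) ^ j)) := by
      have h2 : a = γ * α := by rw [hγdef, inv_mul_cancel_right]
      have h3 : α⁻¹ * β ^ j = β ^ j * (α ^ t' ^ j)⁻¹ := by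
        rw [← conj_pow_exp hαβ j]
        group
      have h4 : α ^ (1 - (t' : ℤ) ^ j) = α * (α ^ t' ^ j)⁻¹ := by
        rw [zpow_sub, zpow_one]
        norm_cast
      have h5 : (α ^ t' ^ j)⁻¹ * α = α * (α ^ t' ^ j)⁻¹ :=
        ((Commute.refl α).pow_left _).inv_left.eq
      calc a⁻¹ * x * a = α⁻¹ * (δ * γ) * α := by
            rw [h2, hx]
            group
        _ = α⁻¹ * (γ * δ) * α := by rw [hγδ.eq]
        _ = γ * (α⁻¹ * β ^ j * α * α) := by
            rw [← mul_assoc, hγα.inv_right.symm.eq, hδdef]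
            simp only [mul_assoc]
        _ = γ * (δ * α ^ (1 - (t' : ℤ) ^ j)) := by
            rw [h3, h4, hδdef, mul_assoc (β ^ j), h5]
            simp only [mul_assoc]
            rw [h5]
    rw [h1]
    refine mul_mem hγx (mul_mem hδx (hαx _ ?_))
    rw [dvd_sub_comm]
    exact hρt'.trans (sub_one_dvd_pow_sub_one _ _)
  have hxb : b⁻¹ * x * b ∈ Subgroup.zpowers x := by
    have h1 : b⁻¹ * x * b = γ ^ t * (δ * α ^ ((t' : ℤ) - 1)) := by
      have h2 : b⁻¹ * γ * b = γ ^ t := by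
        rw [hl]
        exact conj_pow_base h.conj l
      have h3 : b⁻¹ * β ^ j * b = β ^ j := by
        rw [hβdef, ← pow_mul, mul_assoc, ← pow_succ, pow_succ', inv_mul_cancel_left]
      calc b⁻¹ * x * b = (b⁻¹ * γ * b) * ((b⁻¹ * β ^ j * b) * (b⁻¹ * α * b)) := by
            rw [hx, hδdef]
            group
        _ = γ ^ t * (δ * α ^ ((t' : ℤ) - 1)) := by
            rw [h2, h3, hαb, hδdef, mul_assoc (β ^ j), ← zpow_one_add, add_sub_cancel,
              zpow_natCast]
    rw [h1]
    exact mul_mem (Subgroup.pow_mem _ hγx _) (mul_mem hδx (hαx _ hρt'))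
  have hsup : Subgroup.zpowers x ⊔ Subgroup.zpowers b = ⊤ := by
    rw [eq_top_iff, ← f.A_sup_B, h.A_eq, h.B_eq]
    refine sup_le ?_ le_sup_right
    have h1 : a = γ * ((β ^ j)⁻¹ * δ) := by
      rw [hδdef, inv_mul_cancel_left, hγdef, inv_mul_cancel_right]
    rw [Subgroup.zpowers_le]
    nth_rw 1 [h1]
    exact mul_mem (Subgroup.mem_sup_left hγx) (mul_mem
      (Subgroup.mem_sup_right (inv_mem (Subgroup.pow_mem _ hβb j))) (Subgroup.mem_sup_left hδx))
  have hmin := hf (ofZPowers x b (normal_zpowers_of_gen h.cover hxa hxb) hsup)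
  have hcard : Nat.card (Subgroup.zpowers x) < Nat.card f.A := by
    rw [Nat.card_zpowers, hx, hγδ.orderOf_mul_eq_mul_orderOf_of_coprime hcop]
    change _ < mOf f
    rw [← Nat.ordProj_mul_ordCompl_eq_self (mOf f) p, mul_comm]
    have h0 : 0 < ordCompl[p] (mOf f) := Nat.ordCompl_pos p h.mOf_ne_zero
    exact Nat.mul_lt_mul_of_lt_of_le hδlt (Nat.le_of_dvd h0 hγm) h0
  simp only [lex3, factTriple, ofZPowers] at hmin
  omega

end MetacyclicFact.IsGen

/-! ### Comparison with the invariants of a Sylow subgroup -/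

namespace MetacyclicFact

variable {P : Type*} [Group P] [Finite G] {p : ℕ} {φ : G →* P} {f : MetacyclicFact G} {a b : G}
  {t : ℕ}

lemma IsGen.kOf_dvd_nOf (h : f.IsGen a b t) : kOf f ∣ nOf f := by
  have hn := f.normalA
  refine (h.kOf_dvd_iff _).2 ((natPart_dvd h.mOf_ne_zero _).trans ?_)
  have h1 : b ^ nOf f ∈ f.A := Subgroup.pow_index_mem _ _
  rw [h.A_eq] at h1
  obtain ⟨l, hl⟩ := exists_nat_pow_of_mem_zpowers h1
  have h2 := conj_pow_exp h.conj (nOf f)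
  have h3 : Commute a (a ^ l) := (Commute.refl a).pow_right l
  rw [hl, mul_assoc, h3.eq, inv_mul_cancel_left] at h2
  nth_rw 1 [← pow_one a] at h2
  rw [pow_eq_pow_iff_modEq, ← h.mOf_eq] at h2
  exact (Nat.modEq_iff_dvd' (Nat.one_le_pow _ _ h.one_le)).1 h2

lemma commutator_le_A (f : MetacyclicFact G) : commutator G ≤ f.A := by
  obtain ⟨a, b, t, h⟩ := f.exists_isGen
  rw [h.commutator_eq, h.A_eq, Subgroup.zpowers_le]
  exact Subgroup.npow_mem_zpowers _ _

lemma kOf_eq_one_of_isPGroup (f : MetacyclicFact G) (hp : p.Prime) (hG : IsPGroup p G)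
    (he : p ≠ 2 ∨ epsOf f = 1) : kOf f = 1 := by
  obtain ⟨a, b, t, h⟩ := f.exists_isGen
  obtain ⟨i, hi⟩ := (IsPQuot.id_of_isPGroup hp hG).exists_card_subgroup f.A
  rw [← Nat.dvd_one, h.kOf_dvd_iff]
  suffices h1 : natPart (mOf f) {p | ¬ p ∣ rOf f} = 1 by
    rw [h1]
    exact one_dvd _
  refine Finset.prod_eq_one fun q hq => if_neg ?_
  obtain ⟨hqp, hqm, -⟩ := Nat.mem_primeFactors.1 hq
  replace hqm : q ∣ p ^ i := hqm.trans hi.dvd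
  obtain rfl := (Nat.prime_dvd_prime_iff_eq hqp hp).1 (hqp.dvd_of_dvd_pow hqm)
  replace hqm : q ∣ mOf f := hqm.trans hi.symm.dvd
  have h2 := (Nat.modEq_iff_dvd' h.one_le).1 (h.modEq_one hp hG hqm).symm
  refine not_not.2 ?_
  simpa using (h.pow_dvd_rOf_iff hp he 1).2 ⟨by simpa using hqm, by simpa using h2⟩

lemma invariants_of_isMinimalFact (hf : IsMinimalFact f) (hφ : IsPQuot p φ)
    (he : p ≠ 2 ∨ epsOf f = 1) :
    Nat.card (commutator P) * ordProj[p] (rOf f) = ordProj[p] (mOf f) ∧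
    Monoid.exponent P * ordProj[p] (sOf f) = Nat.card P ∧
    ordProj[p] (sOf f) ≤ ordProj[p] (nOf f) ∧
    (ordProj[p] (sOf f) < ordProj[p] (rOf f) →
      ordProj[p] (nOf f) < ordProj[p] (kOf f) * ordProj[p] (sOf f)) ∧
    ∀ (f' : MetacyclicFact P) (r' : ℕ), Nat.card (commutator P) * r' = mOf f' →
      r' < ordProj[p] (rOf f) → ordProj[p] (sOf f) ≤ r' := by
  have hP := hφ.finite
  obtain ⟨a, b, t, h⟩ := f.exists_isGen
  obtain ⟨t', ht', h', hr⟩ := h.exists_niceExp hφ he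
  have hle := h.mOf_map_le_card_B hf hφ ht' h'
  have hcomm := h'.card_commutator
  rw [← hr, ← f.sOf_map hφ, ← f.mOf_map hφ, ← f.nOf_map hφ]
  refine ⟨hcomm, ?_, ?_, ?_, ?_⟩
  · rw [h'.exponent_eq hφ.prime hφ.isPGroup ht' hle, card_B_mul_sOf]
  · rw [← card_inf_mul_sOf, ← card_inf_mul_nOf] at hle
    exact Nat.le_of_mul_le_mul_left hle Nat.card_pos
  · rw [f.nOf_map hφ, f.sOf_map hφ, f.mOf_map hφ]
    exact h.nOf_lt_of_sOf_lt hf hφ h' ht'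
  · intro f' r' hr' hlt
    exact h'.sOf_le_of_lt hφ.prime hφ.isPGroup hle f' hcomm hr' f'.commutator_le_A hlt

lemma ordProj_invariants_of_isPGroup (f : MetacyclicFact G) (hp : p.Prime) (hG : IsPGroup p G) :
    ordProj[p] (mOf f) = mOf f ∧ ordProj[p] (nOf f) = nOf f ∧ ordProj[p] (sOf f) = sOf f ∧
      ordProj[p] (rOf f) = rOf f := by
  obtain ⟨i, hi⟩ := (IsPQuot.id_of_isPGroup hp hG).exists_card_subgroup ⊤
  rw [Subgroup.card_top] at hi
  obtain ⟨a, b, t, h⟩ := f.exists_isGen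
  have key : ∀ d, d ∣ Nat.card G → ordProj[p] d = d := by
    intro d hd
    rw [hi] at hd
    obtain ⟨j, -, rfl⟩ := (Nat.dvd_prime_pow hp).1 hd
    rw [hp.factorization_pow, Finsupp.single_eq_same]
  have hm : mOf f ∣ Nat.card G := Subgroup.card_subgroup_dvd_card _
  exact ⟨key _ hm, key _ (Subgroup.index_dvd_card _), key _ (Subgroup.index_dvd_card _),
    key _ (h.rOf_spec.1.trans hm)⟩

end MetacyclicFact

lemma epsOf_eq_one_of_sylow {P : Type*} [Group P] [Finite G] {φ : G →* P} (hφ : IsPQuot 2 φ)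
    (f : MetacyclicFact G) (fP : MetacyclicFact P) (hfP : IsMinimalFact fP)
    (he : epsOf fP = 1) : epsOf f = 1 := by
  have hP := hφ.finite
  by_contra he1
  obtain ⟨a, b, t, h⟩ := f.exists_isGen
  obtain ⟨hc, h4⟩ := h.card_commutator_of_epsOf_ne_one hφ he1
  have hid := IsPQuot.id_of_isPGroup Nat.prime_two hφ.isPGroup
  obtain ⟨c, d, u, g⟩ := fP.exists_isGen
  obtain ⟨u', hu', g', hR⟩ := g.exists_niceExp hid (Or.inr he)
  have hcR := (MetacyclicFact.invariants_of_isMinimalFact hfP hid (Or.inr he)).1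
  obtain ⟨hM2, -, -, hR2⟩ := fP.ordProj_invariants_of_isPGroup Nat.prime_two hφ.isPGroup
  rw [hM2, hR2] at hR hcR
  have hle : mOf fP ≤ ordProj[2] (mOf f) := by
    rw [← f.mOf_map hφ]
    rcases hfP (f.map φ hφ.surj) with h1 | h1
    · exact h1.le
    · exact h1.1.le
  have h4u : 4 ∣ u' - 1 := (Nat.modEq_iff_dvd' g'.one_le).1 (hu'.2 rfl).symm
  have hR3 : rOf fP ≤ 2 := by
    rw [← hcR, ← hc] at hle
    exact Nat.le_of_mul_le_mul_left hle Nat.card_pos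
  have hR0 : 0 < rOf fP := Nat.pos_of_ne_zero g.rOf_ne_zero
  have h4M : ¬ 4 ∣ mOf fP := by
    intro h5
    have h6 := Nat.le_of_dvd hR0 (hR ▸ Nat.dvd_gcd h5 h4u)
    omega
  have h7 : 2 ∣ Nat.card (commutator P) := by omega
  have h8 : 2 ∣ mOf fP := hcR ▸ h7.mul_right _
  have h9 : 2 ∣ rOf fP := hR ▸ Nat.dvd_gcd h8 (dvd_trans (by norm_num) h4u)
  exact h4M (hcR ▸ mul_dvd_mul h7 h9)

/-- Relations between invariants of `G` and of a Sylow `p`-subgroup, when `ε^{G_p}`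
satisfies `e^{p-1} = 1`. -/
theorem sylow_invariants_relations_eps_one {G : Type*} [Group G] [Finite G]
    (f : MetacyclicFact G) (hf : IsMinimalFact f)
    (p : ℕ) (hp : p.Prime) (hppi : p ∈ piSet G)
    (P : Sylow p G) (fP : MetacyclicFact ↥(P : Subgroup G)) (hfP : IsMinimalFact fP)
    (he : (epsOf fP) ^ (p - 1) = 1) :
    (p = 2 → epsOf f = 1) ∧
    (ordProj[p] (mOf f) / ordProj[p] (rOf f) = mOf fP / rOf fP ∧
      Monoid.exponent ↥(P : Subgroup G) =
        ordProj[p] (mOf f) * ordProj[p] (nOf f) / ordProj[p] (sOf f) ∧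
      Monoid.exponent ↥(P : Subgroup G) = mOf fP * nOf fP / sOf fP) ∧
    (ordProj[p] (mOf f) ≠ mOf fP →
      1 < ordProj[p] (kOf f) ∧ mOf fP ≠ 1 ∧ rOf fP = sOf fP ∧
      ordProj[p] (nOf f) < ordProj[p] (kOf f) * ordProj[p] (sOf f)) := by
  obtain ⟨φ, hφ⟩ := exists_isPQuot_sylow hp hppi P
  have hid := IsPQuot.id_of_isPGroup hp hφ.isPGroup
  have heP : p ≠ 2 ∨ epsOf fP = 1 := by
    refine or_iff_not_imp_left.2 fun h2 => ?_
    rw [not_not] at h2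
    simpa [h2] using he
  have hef : p = 2 → epsOf f = 1 := by
    rintro rfl
    exact epsOf_eq_one_of_sylow hφ f fP hfP (heP.resolve_left (by simp))
  obtain ⟨hm, hexp, hsn, hlt, hs⟩ :=
    MetacyclicFact.invariants_of_isMinimalFact hf hφ (or_iff_not_imp_left.2 (hef <| not_not.1 ·))
  obtain ⟨hM, hExp, hSN, hLt, -⟩ := MetacyclicFact.invariants_of_isMinimalFact hfP hid heP
  obtain ⟨hMp, hNp, hSp, hRp⟩ := fP.ordProj_invariants_of_isPGroup hp hφ.isPGroup
  rw [fP.kOf_eq_one_of_isPGroup hp hφ.isPGroup heP] at hLt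
  rw [hMp, hRp] at hM
  rw [hSp] at hExp
  rw [hSp, hNp] at hSN
  rw [hSp, hNp, hRp] at hLt
  have hsS : ordProj[p] (sOf f) = sOf fP :=
    Nat.eq_of_mul_eq_mul_left (Nat.pos_of_ne_zero Monoid.exponent_ne_zero_of_finite)
      (hexp.trans hExp.symm)
  have hr0 : 0 < ordProj[p] (rOf f) := pow_pos hp.pos _
  have hs0 : 0 < ordProj[p] (sOf f) := pow_pos hp.pos _
  have hS0 : 0 < sOf fP := hsS ▸ hs0
  have hR0 : 0 < rOf fP := hRp ▸ pow_pos hp.pos _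
  have hc0 : 0 < Nat.card (commutator (P : Subgroup G)) := Nat.card_pos
  refine ⟨hef, ⟨?_, ?_, ?_⟩, fun hne => ?_⟩
  · rw [← hm, ← hM, Nat.mul_div_cancel _ hr0, Nat.mul_div_cancel _ hR0]
  · rw [← f.mOf_map hφ, ← f.nOf_map hφ, MetacyclicFact.mOf_mul_nOf, ← hexp,
      Nat.mul_div_cancel _ hs0]
  · rw [MetacyclicFact.mOf_mul_nOf, ← hExp, Nat.mul_div_cancel _ hS0]
  · have hle : mOf fP < ordProj[p] (mOf f) := by
      refine lt_of_le_of_ne ?_ hne.symm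
      rw [← f.mOf_map hφ]
      rcases hfP (f.map φ hφ.surj) with h1 | h1
      · exact h1.le
      · exact h1.1.le
    have hRr : rOf fP < ordProj[p] (rOf f) := by
      rw [← hm, ← hM] at hle
      exact Nat.lt_of_mul_lt_mul_left hle
    have hsR := hs fP _ hM hRr
    have hRS : rOf fP = sOf fP := by
      refine le_antisymm ?_ (hsS ▸ hsR)
      by_contra! h1
      have := hLt h1
      simp at this
      omega
    have hnk := hlt (hsR.trans_lt hRr)
    obtain ⟨a, b, t, h⟩ := f.exists_isGen
    have hn0 : nOf f ≠ 0 := Subgroup.index_ne_zero_of_finite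
    have hkn : ordProj[p] (kOf f) ≤ ordProj[p] (nOf f) :=
      Nat.le_of_dvd (pow_pos hp.pos _)
        (pow_dvd_ordProj_of_dvd hp hn0 ((Nat.ordProj_dvd _ _).trans h.kOf_dvd_nOf))
    refine ⟨?_, fun hM1 => ?_, hRS, hnk⟩
    · by_contra! hk
      have h1 := Nat.mul_le_mul_right (ordProj[p] (sOf f)) hk
      omega
    · have h1 : rOf fP = 1 := by
        rw [hM1] at hM
        exact Nat.eq_one_of_mul_eq_one_left hM
      rw [hsS, ← hRS, h1, mul_one] at hnk
      omega

end ArXiv230800432
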